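/- arXiv:1612.07881 — 6 statements merged into one kernel-verified Lean document; each statement's English description precedes it below -/
import Mathlib

section
/- Let A be a finite alphabet and X ⊆ A*. If (u,v) is a synchronizing pair of X, then the word u·v is a constant of X. -/
/-- The Kleene star of a set of words: the submonoid of the free monoid generated by `X`. -/
def Kstar {A : Type*} (X : Set (List A)) : Set (List A) :=
  {w | ∃ l : List (List A), (∀ x ∈ l, x ∈ X) ∧ l.flatten = w}

/-- `X` is complete: every word has an `X`-completion. -/
def IsCompleteSet {A : Type*} (X : Set (List A)) : Prop :=
  ∀ w : List A, ∃ r s : List A, r ++ w ++ s ∈ Kstar X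

/-- `(u, v)` is a synchronizing pair of `X`. -/
def IsSyncPair {A : Type*} (X : Set (List A)) (u v : List A) : Prop :=
  u ∈ Kstar X ∧ v ∈ Kstar X ∧
    ∀ r s : List A, r ++ (u ++ v) ++ s ∈ Kstar X →
      r ++ u ∈ Kstar X ∧ v ++ s ∈ Kstar X

/-- `X` is synchronizing: it has a synchronizing pair. -/
def IsSynchronizing {A : Type*} (X : Set (List A)) : Prop :=
  ∃ u v : List A, IsSyncPair X u v

/-- `c` is a constant of `X`. -/
def IsConstant {A : Type*} (X : Set (List A)) (c : List A) : Prop :=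
  c ∈ Kstar X ∧ ∀ u₁ u₂ u₃ u₄ : List A,
    u₁ ++ c ++ u₂ ∈ Kstar X → u₃ ++ c ++ u₄ ∈ Kstar X →
      u₁ ++ c ++ u₄ ∈ Kstar X ∧ u₃ ++ c ++ u₂ ∈ Kstar X

/-- `X` is a code: every word of `X*` has a unique factorization into words of `X`. -/
def IsCode {A : Type*} (X : Set (List A)) : Prop :=
  ∀ l₁ l₂ : List (List A), (∀ x ∈ l₁, x ∈ X) → (∀ x ∈ l₂, x ∈ X) →
    l₁.flatten = l₂.flatten → l₁ = l₂

/-- `X` is a prefix code: no word of `X` is a proper prefix of another, and `X ≠ {ε}`. -/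
def IsPrefixCode {A : Type*} (X : Set (List A)) : Prop :=
  (∀ x ∈ X, ∀ y ∈ X, x <+: y → x = y) ∧ X ≠ {([] : List A)}

/-- The monoid morphism `A* → B*` generated by the map `f` on letters. -/
def mlift {A B : Type*} (f : A → List B) : List A → List B :=
  fun w => (w.map f).flatten

/-- The Kleene star is closed under concatenation. -/
theorem append_mem_Kstar {A : Type*} {X : Set (List A)} {x y : List A}
    (hx : x ∈ Kstar X) (hy : y ∈ Kstar X) : x ++ y ∈ Kstar X := by
  obtain ⟨l, hl, rfl⟩ := hx
  obtain ⟨m, hm, rfl⟩ := hy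
  exact ⟨l ++ m, fun x hx => (List.mem_append.1 hx).elim (hl x) (hm x), List.flatten_append⟩

/-- If `(u, v)` is a synchronizing pair of `X`, then `u ++ v` is a constant of `X`. -/
theorem syncPair_concat_isConstant {A : Type*} [Fintype A] (X : Set (List A))
    (u v : List A) (h : IsSyncPair X u v) : IsConstant X (u ++ v) := by
  obtain ⟨hu, hv, hsync⟩ := h
  refine ⟨append_mem_Kstar hu hv, fun u₁ u₂ u₃ u₄ h₁ h₂ => ?_⟩
  obtain ⟨hl₁, hr₁⟩ := hsync _ _ h₁
  obtain ⟨hl₂, hr₂⟩ := hsync _ _ h₂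
  exact ⟨by simpa using append_mem_Kstar hl₁ hr₂, by simpa using append_mem_Kstar hl₂ hr₁⟩
end

section
/- Let k_1, …, k_n and d be positive integers such that gcd(k_1, …, k_n) = 1 and Σ_{i=1}^n d^{-k_i} = 1. Then there exists a synchronizing complete prefix code X = {x_1, …, x_n} of n distinct words over a d-letter alphabet such that |x_i| = k_i for every i = 1, …, n. -/
/-! ### Automata and stable pairs of states -/

section Automaton

variable {Q A : Type*}

/-- The action of words on the states of a deterministic automaton. -/
def run (δ : Q → A → Q) (q : Q) (w : List A) : Q := w.foldl δ q

theorem run_append (δ : Q → A → Q) (q : Q) (u v : List A) :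
    run δ q (u ++ v) = run δ (run δ q u) v := by
  simp [run]

/-- Two states are stable if every word can be prolonged to a word that merges them. -/
def Stable (δ : Q → A → Q) (p q : Q) : Prop :=
  ∀ u, ∃ v, run δ p (u ++ v) = run δ q (u ++ v)

theorem Stable.refl (δ : Q → A → Q) (p : Q) : Stable δ p p := fun _ => ⟨[], rfl⟩

theorem Stable.symm {δ : Q → A → Q} {p q : Q} (h : Stable δ p q) : Stable δ q p := fun u => by
  obtain ⟨v, hv⟩ := h u
  exact ⟨v, hv.symm⟩

theorem Stable.trans {δ : Q → A → Q} {p q r : Q} (h : Stable δ p q) (h' : Stable δ q r) :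
    Stable δ p r := fun u => by
  obtain ⟨v, hv⟩ := h u
  obtain ⟨v', hv'⟩ := h' (u ++ v)
  refine ⟨v ++ v', ?_⟩
  rw [← List.append_assoc, run_append, hv, ← run_append, hv']

theorem Stable.run {δ : Q → A → Q} {p q : Q} (h : Stable δ p q) (w : List A) :
    Stable δ (run δ p w) (run δ q w) := fun u => by
  obtain ⟨v, hv⟩ := h (w ++ u)
  refine ⟨v, ?_⟩
  rw [← run_append, ← run_append, ← List.append_assoc, hv]

/-- A finite set of states that are stable with `r` is merged with `r` by some word. -/
theorem exists_merging_word (δ : Q → A → Q) (r : Q) (s : Finset Q)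
    (hs : ∀ q ∈ s, Stable δ q r) : ∃ v, ∀ q ∈ s, run δ q v = run δ r v := by
  classical
  induction s using Finset.induction_on with
  | empty => exact ⟨[], by simp⟩
  | insert a s _ ih =>
    obtain ⟨v, hv⟩ := ih fun q hq => hs q (Finset.mem_insert_of_mem hq)
    obtain ⟨v', hv'⟩ := hs a (Finset.mem_insert_self _ _) v
    refine ⟨v ++ v', fun q hq => ?_⟩
    rcases Finset.mem_insert.1 hq with rfl | hq
    · exact hv'
    · rw [run_append, hv q hq, ← run_append]

/-- In a finite strongly connected automaton every state lies in an image of the state set of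
minimal cardinality, on which therefore all words act injectively. -/
theorem exists_minimal_image [Finite Q] (δ : Q → A → Q) (conn : ∀ p q, ∃ u, run δ p u = q)
    (p : Q) : ∃ w, p ∈ Set.range (run δ · w) ∧
      ∀ u, Set.InjOn (run δ · u) (Set.range (run δ · w)) := by
  obtain ⟨w₀, hw₀⟩ : ∃ w₀, ∀ w,
      (Set.range (run δ · w₀)).ncard ≤ (Set.range (run δ · w)).ncard :=
    ⟨_, fun w => Function.argmin_le (fun w => (Set.range (run δ · w)).ncard) w⟩
  have image (w u : List A) :
      (run δ · u) '' Set.range (run δ · w) = Set.range (run δ · (w ++ u)) := by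
    ext q
    simp [run_append]
  obtain ⟨u, hu⟩ := conn (run δ p w₀) p
  refine ⟨w₀ ++ u, ⟨p, by simp [run_append, hu]⟩, fun v => ?_⟩
  apply Set.injOn_of_ncard_image_eq _ (Set.toFinite _)
  apply le_antisymm (Set.ncard_image_le (Set.toFinite _))
  rw [image, ← image w₀ u]
  exact (Set.ncard_image_le (Set.toFinite _)).trans (hw₀ _)

theorem stable_of_unique_exception [Finite Q] (δ : Q → A → Q)
    (conn : ∀ p q, ∃ u, run δ p u = q) (p : Q) (α β γ : List A)
    (h : ∀ s, run δ s (α ++ γ) = run δ p (α ++ γ) ∨ run δ s (α ++ β) = run δ s α) :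
    Stable δ (run δ p α) (run δ p (α ++ β)) := by
  obtain ⟨w, hp, hinj⟩ := exists_minimal_image δ conn p
  set F := Set.range (run δ · w) with hF
  intro u
  refine ⟨w, ?_⟩
  simp only [← run_append]
  have maps : Set.MapsTo (run δ · (α ++ (u ++ w))) F F := fun s _ =>
    ⟨run δ s (α ++ u), by simp [run_append]⟩
  have surj : Set.SurjOn (run δ · (α ++ (u ++ w))) F F :=
    ((Set.toFinite F).injOn_iff_bijOn_of_mapsTo maps |>.1 (hinj _)).surjOn
  have mem : run δ p (α ++ β ++ (u ++ w)) ∈ F := ⟨run δ p (α ++ β ++ u), by simp [run_append]⟩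
  obtain ⟨s, hs, hsp⟩ := surj mem
  rcases h s with h | h
  · rw [hinj (α ++ γ) hs hp h] at hsp
    exact hsp
  · have : s = p := hinj (α ++ β ++ (u ++ w)) hs hp (by
      simp only [← hsp]
      rw [run_append, h, ← run_append])
    rw [this] at hsp
    exact hsp

end Automaton

/-! ### Trees and their automata -/

section Tree

variable {A ι : Type*}

/-- `T` is the set of inner nodes of a tree with leaves `x`. -/
structure IsTree (T : Set (List A)) (x : ι → List A) : Prop where
  nil_mem : [] ∈ T
  of_append : ∀ w a, w ++ [a] ∈ T → w ∈ T
  leaf : ∀ i, ∃ w ∈ T, ∃ a, x i = w ++ [a]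
  leaf_notMem : ∀ i, x i ∉ T
  injective : Function.Injective x
  exists_leaf : ∀ w ∈ T, ∀ a, w ++ [a] ∉ T → ∃ i, x i = w ++ [a]

variable {T : Set (List A)} {x : ι → List A}

theorem IsTree.of_prefix (h : IsTree T x) {u w : List A} (hu : u <+: w) (hw : w ∈ T) :
    u ∈ T := by
  obtain ⟨v, rfl⟩ := hu
  induction v using List.reverseRecOn with
  | nil => simpa using hw
  | append_singleton v a ih => exact ih (h.of_append _ a (by simpa using hw))

theorem IsTree.mem_of_prefix_leaf (h : IsTree T x) {u : List A} {i : ι} (hu : u <+: x i)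
    (hne : u ≠ x i) : u ∈ T := by
  obtain ⟨w, hw, a, hx⟩ := h.leaf i
  rw [hx] at hu hne
  rcases List.prefix_concat_iff.1 hu with h' | h'
  · exact absurd h' hne
  · exact h.of_prefix h' hw

theorem IsTree.eq_of_prefix (h : IsTree T x) {i j : ι} (hij : x i <+: x j) : i = j := by
  by_contra hne
  exact h.leaf_notMem i (h.mem_of_prefix_leaf hij fun e => hne (h.injective e))

theorem IsTree.leaf_ne_nil (h : IsTree T x) (i : ι) : x i ≠ [] := fun e =>
  h.leaf_notMem i (e ▸ h.nil_mem)

open Classical in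
/-- The automaton of a tree: reaching a leaf leads back to the root. -/
noncomputable def IsTree.step (h : IsTree T x) (q : T) (a : A) : T :=
  if hq : q.1 ++ [a] ∈ T then ⟨_, hq⟩ else ⟨[], h.nil_mem⟩

/-- The root of a tree, as a state of its automaton. -/
def IsTree.root (h : IsTree T x) : T := ⟨[], h.nil_mem⟩

theorem IsTree.run_of_mem (h : IsTree T x) (q : T) (w : List A) (hw : q.1 ++ w ∈ T) :
    run h.step q w = ⟨q.1 ++ w, hw⟩ := by
  induction w using List.reverseRecOn with
  | nil => ext1; simp [run]
  | append_singleton w a ih =>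
    have hw' : q.1 ++ w ∈ T := h.of_append _ a (by simpa using hw)
    rw [run_append, ih hw']
    ext1
    have : q.1 ++ (w ++ [a]) ∈ T := hw
    simp [run, IsTree.step, this]

theorem IsTree.run_root_of_mem (h : IsTree T x) {w : List A} (hw : w ∈ T) :
    run h.step h.root w = ⟨w, hw⟩ :=
  h.run_of_mem h.root w hw

theorem IsTree.run_leaf (h : IsTree T x) (q : T) {w : List A} {i : ι} (hw : q.1 ++ w = x i) :
    run h.step q w = h.root := by
  have hx := h.leaf_notMem i
  rw [← hw] at hx
  rcases List.eq_nil_or_concat w with rfl | ⟨w, a, rfl⟩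
  · exact absurd q.2 (by simp at hx)
  · rw [List.concat_eq_append] at hw hx ⊢
    have hw' : q.1 ++ w ∈ T := h.mem_of_prefix_leaf (i := i)
      (by rw [← hw, ← List.append_assoc]; exact List.prefix_append _ _)
      (by rw [← hw]; simp)
    rw [run_append, h.run_of_mem q w hw']
    have : q.1 ++ (w ++ [a]) ∉ T := hx
    simp [run, IsTree.step, this, IsTree.root]

theorem IsTree.run_root_leaf (h : IsTree T x) (i : ι) : run h.step h.root (x i) = h.root :=
  h.run_leaf h.root (i := i) rfl

theorem IsTree.mem_or_leaf_prefix (h : IsTree T x) {q : List A} (hq : q ∈ T) (w : List A) :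
    q ++ w ∈ T ∨ ∃ w₁ w₂ i, w = w₁ ++ w₂ ∧ q ++ w₁ = x i := by
  induction w using List.reverseRecOn with
  | nil => left; simpa using hq
  | append_singleton w a ih =>
    rcases ih with ih | ⟨w₁, w₂, i, rfl, hi⟩
    · by_cases hw : q ++ w ++ [a] ∈ T
      · left; simpa using hw
      · obtain ⟨i, hi⟩ := h.exists_leaf _ ih a hw
        exact Or.inr ⟨w ++ [a], [], i, by simp, by simp [hi]⟩
    · exact Or.inr ⟨w₁, w₂ ++ [a], i, by simp, hi⟩

/-- A word that returns to the root is a product of leaves. -/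
theorem IsTree.exists_factorization (h : IsTree T x) (w : List A)
    (hw : run h.step h.root w = h.root) : ∃ l : List ι, mlift x l = w := by
  induction hn : w.length using Nat.strong_induction_on generalizing w with
  | _ n ih =>
    rcases h.mem_or_leaf_prefix h.nil_mem w with hT | ⟨w₁, w₂, i, rfl, hi⟩
    · rw [List.nil_append] at hT
      rw [h.run_root_of_mem hT, IsTree.root, Subtype.mk.injEq] at hw
      exact ⟨[], by simp [mlift, hw]⟩
    · rw [List.nil_append] at hi
      subst hi
      rw [run_append, h.run_root_leaf] at hw
      have := List.length_pos_iff.2 (h.leaf_ne_nil i)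
      obtain ⟨l, hl⟩ := ih w₂.length (by simp at hn; omega) w₂ hw rfl
      exact ⟨i :: l, by simp [mlift] at hl ⊢; exact hl⟩

theorem IsTree.run_root_mlift (h : IsTree T x) (l : List ι) :
    run h.step h.root (mlift x l) = h.root := by
  induction l with
  | nil => rfl
  | cons i l ih =>
    rw [show mlift x (i :: l) = x i ++ mlift x l by simp [mlift], run_append, h.run_root_leaf, ih]

theorem IsTree.exists_leaf_extending (h : IsTree T x) [Nonempty A] {N : ℕ}
    (hN : ∀ w ∈ T, w.length < N) {w : List A} (hw : w ∈ T) : ∃ i v, w ++ v = x i := by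
  obtain ⟨a⟩ := ‹Nonempty A›
  rcases h.mem_or_leaf_prefix hw (List.replicate N a) with hT | ⟨w₁, w₂, i, _, hi⟩
  · have := hN _ hT
    simp at this
  · exact ⟨i, w₁, hi⟩

theorem IsTree.connected (h : IsTree T x) [Nonempty A] {N : ℕ}
    (hN : ∀ w ∈ T, w.length < N) (p q : T) : ∃ u, run h.step p u = q := by
  obtain ⟨i, v, hv⟩ := h.exists_leaf_extending hN p.2
  exact ⟨v ++ q.1, by rw [run_append, h.run_leaf p hv, h.run_root_of_mem q.2]⟩

end Tree

/-! ### Construction of trees with prescribed leaf lengths -/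

section Construction

/-- The numbers of inner nodes of each depth in a tree whose leaves have depths `k`. -/
theorem exists_inner_counts {ι : Type*} [Fintype ι] (d : ℕ) (hd : 0 < d) (k : ι → ℕ)
    (hk : ∀ i, 0 < k i) (hsum : ∑ i, ((d : ℚ) ^ k i)⁻¹ = 1) :
    ∃ t : ℕ → ℕ, t 0 = 1 ∧
      (∀ l, t (l + 1) + (Finset.univ.filter fun i => k i = l + 1).card = d * t l) ∧
      ∀ l, 0 < t l ↔ ∃ i, l < k i := by
  classical
  have hdQ : (0 : ℚ) < d := by exact_mod_cast hd
  set f : ℕ → ℚ := fun l => (d : ℚ) ^ l * ∑ i with l < k i, ((d : ℚ) ^ k i)⁻¹ with hf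
  have f0 : f 0 = 1 := by
    simp only [hf, pow_zero, one_mul]
    rw [Finset.filter_true_of_mem fun i _ => hk i, hsum]
  have fnonneg (l : ℕ) : 0 ≤ f l := by positivity
  have fsucc (l : ℕ) : f (l + 1) + (Finset.univ.filter fun i => k i = l + 1).card = d * f l := by
    have split : ∑ i with l < k i, ((d : ℚ) ^ k i)⁻¹ =
        ∑ i with l + 1 < k i, ((d : ℚ) ^ k i)⁻¹ + ∑ i with k i = l + 1, ((d : ℚ) ^ k i)⁻¹ := by
      rw [← Finset.sum_union (Finset.disjoint_filter.2 fun i _ h h' => by omega)]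
      congr 1
      ext i
      simp only [Finset.mem_filter_univ, Finset.mem_union]
      omega
    have const : ∑ i with k i = l + 1, ((d : ℚ) ^ k i)⁻¹ =
        (Finset.univ.filter fun i => k i = l + 1).card * ((d : ℚ) ^ (l + 1))⁻¹ := by
      rw [Finset.sum_congr rfl fun i hi => by rw [(Finset.mem_filter.1 hi).2], Finset.sum_const,
        nsmul_eq_mul]
    simp only [hf]
    rw [split, const]
    have : (d : ℚ) ^ (l + 1) * ((d : ℚ) ^ (l + 1))⁻¹ = 1 := mul_inv_cancel₀ (by positivity)
    linear_combination (-1 : ℚ) * (Finset.univ.filter fun i => k i = l + 1).card * this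
  have cast (l : ℕ) : ∃ c : ℕ, (c : ℚ) = f l := by
    induction l with
    | zero => exact ⟨1, by simp [f0]⟩
    | succ l ih =>
      obtain ⟨c, hc⟩ := ih
      have h1 := fsucc l
      have h2 := fnonneg (l + 1)
      rw [← hc] at h1
      have h3 : (Finset.univ.filter fun i => k i = l + 1).card ≤ d * c := by
        have : ((Finset.univ.filter fun i => k i = l + 1).card : ℚ) ≤ d * c := by linarith
        exact_mod_cast this
      refine ⟨d * c - (Finset.univ.filter fun i => k i = l + 1).card, ?_⟩
      rw [Nat.cast_sub h3]
      push_cast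
      linarith
  choose t ht using cast
  refine ⟨t, ?_, fun l => ?_, fun l => ?_⟩
  · have := ht 0
    rw [f0] at this
    exact_mod_cast this
  · have := fsucc l
    rw [← ht, ← ht] at this
    exact_mod_cast this
  · have : 0 < t l ↔ 0 < f l := by rw [← ht]; exact Nat.cast_pos.symm
    rw [this]
    constructor
    · intro h
      by_contra! hl
      have : f l = 0 := by
        simp only [hf]
        rw [Finset.filter_false_of_mem fun i _ => not_lt.2 (hl i)]
        simp
      exact h.ne' this
    · rintro ⟨i, hi⟩
      exact mul_pos (by positivity) (Finset.sum_pos (fun i _ => by positivity) ⟨i, by simpa using hi⟩)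

variable {A : Type*} [Fintype A] [DecidableEq A]

/-- The words obtained from those of `S` by appending a letter. -/
def children (S : Finset (List A)) : Finset (List A) :=
  (S ×ˢ Finset.univ).image fun p : List A × A => p.1 ++ [p.2]

theorem append_mem_children {S : Finset (List A)} {w : List A} {a : A} :
    w ++ [a] ∈ children S ↔ w ∈ S := by
  simp [children]

theorem mem_children {S : Finset (List A)} {w : List A} :
    w ∈ children S ↔ ∃ u ∈ S, ∃ a, u ++ [a] = w := by
  simp [children]

theorem card_children (S : Finset (List A)) :
    (children S).card = Fintype.card A * S.card := by
  rw [children, Finset.card_image_of_injective, Finset.card_product, Finset.card_univ, mul_comm]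
  rintro ⟨u, a⟩ ⟨v, b⟩ h
  simpa using h

variable (A) in
/-- The words of length `l`. -/
def wordsOfLength : ℕ → Finset (List A)
  | 0 => {[]}
  | l + 1 => children (wordsOfLength l)

theorem mem_wordsOfLength {l : ℕ} {w : List A} : w ∈ wordsOfLength A l ↔ w.length = l := by
  induction l generalizing w with
  | zero => simp [wordsOfLength]
  | succ l ih =>
    rcases List.eq_nil_or_concat w with rfl | ⟨w, a, rfl⟩
    · simp [wordsOfLength, mem_children]
    · simp [wordsOfLength, append_mem_children, ih]

theorem card_wordsOfLength (l : ℕ) : (wordsOfLength A l).card = Fintype.card A ^ l := by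
  induction l with
  | zero => simp [wordsOfLength]
  | succ l ih => rw [wordsOfLength, card_children, ih, pow_succ']

/-- There is a sequence of sets of nodes with given sizes `t`, containing the nodes in `R` and
avoiding those in `F`. -/
theorem exists_levels (t : ℕ → ℕ) (R F : ℕ → Finset (List A)) (t0 : t 0 = 1)
    (hF : ∀ l, t (l + 1) + (F (l + 1)).card ≤ Fintype.card A * t l)
    (hR : ∀ l, (R l).card ≤ t l) (hRF : ∀ l, ∀ r ∈ R l, r.length = l ∧ r ∉ F l)
    (hRR : ∀ l, ∀ r ∈ R (l + 1), r.dropLast ∈ R l ∨ t l = Fintype.card A ^ l) :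
    ∃ S : ℕ → Finset (List A), S 0 = {[]} ∧ (∀ l, ∀ w ∈ S l, w.length = l) ∧
      (∀ l, (S l).card = t l) ∧ (∀ l, R l ⊆ S l) ∧
      ∀ l, S (l + 1) ⊆ children (S l) \ F (l + 1) := by
  let Good (l : ℕ) (T : Finset (List A)) : Prop :=
    (∀ w ∈ T, w.length = l) ∧ T.card = t l ∧ R l ⊆ T
  have next (l : ℕ) (T : {T // Good l T}) :
      ∃ T' : {T // Good (l + 1) T}, T'.1 ⊆ children T.1 \ F (l + 1) := by
    obtain ⟨T, hT, hcard, hRT⟩ := T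
    have sub : R (l + 1) ⊆ children T \ F (l + 1) := by
      intro r hr
      obtain ⟨hlen, hrF⟩ := hRF _ r hr
      refine Finset.mem_sdiff.2 ⟨?_, hrF⟩
      rcases List.eq_nil_or_concat r with rfl | ⟨w, a, rfl⟩
      · simp at hlen
      · rw [List.concat_eq_append] at *
        rw [append_mem_children]
        rcases hRR l _ hr with h | h
        · exact hRT (by simpa using h)
        · have : T = wordsOfLength A l := Finset.eq_of_subset_of_card_le
            (fun w hw => mem_wordsOfLength.2 (hT w hw)) (by rw [card_wordsOfLength, hcard, h])
          rw [this, mem_wordsOfLength]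
          simpa using hlen
    have le : t (l + 1) ≤ (children T \ F (l + 1)).card := by
      have h1 := Finset.le_card_sdiff (F (l + 1)) (children T)
      rw [card_children, hcard] at h1
      have h2 := hF l
      omega
    obtain ⟨T', h1, h2, h3⟩ := Finset.exists_subsuperset_card_eq sub (hR _) le
    refine ⟨⟨T', fun w hw => ?_, h3, h1⟩, h2⟩
    obtain ⟨u, hu, a, rfl⟩ := mem_children.1 (Finset.mem_sdiff.1 (h2 hw)).1
    simp [hT u hu]
  choose nxt hnxt using next
  have good0 : Good 0 {[]} := ⟨by simp, by simp [t0], fun r hr => by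
    simpa using (hRF 0 r hr).1⟩
  let S (l : ℕ) : {T // Good l T} := Nat.rec ⟨{[]}, good0⟩ nxt l
  exact ⟨fun l => (S l).1, rfl, fun l => (S l).2.1, fun l => (S l).2.2.1, fun l => (S l).2.2.2,
    fun l => hnxt l (S l)⟩

/-- The inner nodes given by `exists_levels` form a tree whose leaves have lengths `k`. -/
theorem exists_isTree {ι : Type*} [Fintype ι] (k : ι → ℕ) (hk : ∀ i, 0 < k i) (t : ℕ → ℕ)
    (ht : ∀ l, t (l + 1) + (Finset.univ.filter fun i => k i = l + 1).card =
      Fintype.card A * t l)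
    (S : ℕ → Finset (List A)) (S0 : S 0 = {[]}) (hlen : ∀ l, ∀ w ∈ S l, w.length = l)
    (hcard : ∀ l, (S l).card = t l) (hS : ∀ l, S (l + 1) ⊆ children (S l)) :
    ∃ x : ι → List A, IsTree {w | w ∈ S w.length} x ∧ ∀ i, (x i).length = k i := by
  classical
  have card_eq (l : ℕ) : (Finset.univ.filter fun i => k i = l + 1).card =
      (children (S l) \ S (l + 1)).card := by
    rw [Finset.card_sdiff_of_subset (hS l), card_children, hcard, hcard, ← ht]
    omega
  let e (l : ℕ) := Finset.equivOfCardEq (card_eq l)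
  have hk' (i : ι) : i ∈ Finset.univ.filter fun j => k j = k i - 1 + 1 := by
    have := hk i
    simp
    omega
  let x (i : ι) : List A := (e (k i - 1) ⟨i, hk' i⟩).1
  have x_eq (i : ι) (l : ℕ) (hl : k i - 1 = l) (hi : i ∈ Finset.univ.filter fun j => k j = l + 1) :
      x i = (e l ⟨i, hi⟩).1 := by
    subst hl
    rfl
  have hx (i : ι) : x i ∈ children (S (k i - 1)) \ S (k i - 1 + 1) := (e _ ⟨i, hk' i⟩).2
  have xlen (i : ι) : (x i).length = k i := by
    obtain ⟨u, hu, a, hua⟩ := mem_children.1 (Finset.mem_sdiff.1 (hx i)).1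
    have := hk i
    rw [← hua]
    simp [hlen _ u hu]
    omega
  refine ⟨x, ⟨?_, ?_, ?_, ?_, ?_, ?_⟩, xlen⟩
  · simp [S0]
  · intro w a h
    have : w ++ [a] ∈ S (w.length + 1) := by simpa using h
    exact append_mem_children.1 (hS _ this)
  · intro i
    obtain ⟨u, hu, a, hua⟩ := mem_children.1 (Finset.mem_sdiff.1 (hx i)).1
    refine ⟨u, ?_, a, hua.symm⟩
    rw [Set.mem_ofPred_eq, hlen _ u hu]
    exact hu
  · intro i
    have := (Finset.mem_sdiff.1 (hx i)).2
    rwa [Set.mem_ofPred_eq, xlen, show k i = k i - 1 + 1 by have := hk i; omega]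
  · intro i j hij
    have hkij : k i = k j := by rw [← xlen i, ← xlen j, hij]
    have key (l : ℕ) (hi : i ∈ Finset.univ.filter fun j => k j = l + 1)
        (hj : j ∈ Finset.univ.filter fun j => k j = l + 1)
        (h : (e l ⟨i, hi⟩).1 = (e l ⟨j, hj⟩).1) : i = j := by
      simpa using (e l).injective (Subtype.ext h)
    apply key (k i - 1) (hk' i) (by rw [hkij]; exact hk' j)
    rw [← x_eq j (k i - 1) (by rw [hkij])]
    exact hij
  · intro w hw a ha
    have ha' : w ++ [a] ∉ S (w.length + 1) := by simpa using ha
    have mem : w ++ [a] ∈ children (S w.length) \ S (w.length + 1) :=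
      Finset.mem_sdiff.2 ⟨append_mem_children.2 hw, ha'⟩
    obtain ⟨⟨i, hi⟩, hie⟩ := (e w.length).surjective ⟨_, mem⟩
    refine ⟨i, ?_⟩
    have hki : k i - 1 = w.length := by simp at hi; omega
    rw [x_eq i _ hki hi, hie]

end Construction

/-! ### A tree in which the root is stable with another node -/

section StableRoot

theorem one_lt_card_of_kraft {ι : Type*} [Fintype ι] {d : ℕ} {k : ι → ℕ} (hk : ∀ i, 0 < k i)
    (hsum : ∑ i, ((d : ℚ) ^ k i)⁻¹ = 1) {i j : ι} (hij : k i ≠ k j) : 1 < d := by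
  by_contra! hd
  interval_cases d
  · simp [fun i => (hk i).ne'] at hsum
  · simp only [Nat.cast_one, one_pow, inv_one, Finset.sum_const, Finset.card_univ, nsmul_eq_mul,
      mul_one] at hsum
    have : Fintype.card ι = 1 := by exact_mod_cast hsum
    have := Fintype.card_le_one_iff_subsingleton.1 this.le
    exact hij (congrArg k (Subsingleton.elim i j))

variable {A ι : Type*} {T : Set (List A)} {x : ι → List A}

theorem IsTree.run_exit (h : IsTree T x) (q : T) {w : List A} {c : A} (hw : q.1 ++ w ∈ T)
    (hc : q.1 ++ (w ++ [c]) ∉ T) : run h.step q (w ++ [c]) = h.root := by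
  obtain ⟨i, hi⟩ := h.exists_leaf _ hw c (by simpa using hc)
  exact h.run_leaf q (i := i) (by simpa using hi.symm)

theorem IsTree.stable_root [Nonempty A] (h : IsTree T x) {N : ℕ} (hN : ∀ w ∈ T, w.length < N)
    (fin : T.Finite) (a b : A) (m n : ℕ)
    (hchain : List.replicate (m + 1) a ∉ T) (hb : List.replicate m a ++ [b] ∈ T)
    (p : T) (hp : p.1 ++ List.replicate n a ∈ T)
    (hpa : p.1 ++ (List.replicate n a ++ [a]) ∉ T)
    (hpb : p.1 ++ (List.replicate n a ++ [b]) ∉ T)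
    (hheight : ∀ s ∈ T, s ≠ [] → s ++ List.replicate (n + 1) a ∉ T) :
    Stable h.step h.root ⟨_, hb⟩ := by
  have := fin.to_subtype
  have hm : List.replicate m a ∈ T := h.of_append _ b hb
  have cycle : run h.step h.root (List.replicate (m + 1) a) = h.root := by
    rw [List.replicate_succ']
    refine h.run_exit _ (by simpa [IsTree.root] using hm) ?_
    simpa [IsTree.root, List.replicate_succ'] using hchain
  have periodic (r : ℕ) : run h.step h.root (List.replicate r a ++ List.replicate (m + 1) a) =
      run h.step h.root (List.replicate r a) := by
    rw [List.replicate_append_replicate, add_comm, ← List.replicate_append_replicate, run_append,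
      cycle]
  have exit : run h.step p (List.replicate n a ++ [a]) = h.root := h.run_exit p hp hpa
  have key := stable_of_unique_exception h.step (h.connected hN) p (List.replicate n a)
    (List.replicate (m + 1) a) [a] fun s => by
      rw [exit]
      by_cases hs : s.1 = []
      · right
        rw [show s = h.root from Subtype.ext hs, periodic]
      · rcases h.mem_or_leaf_prefix s.2 (List.replicate (n + 1) a) with hT | ⟨w₁, w₂, i, hw, hi⟩
        · exact absurd hT (hheight _ s.2 hs)
        · have hrun := h.run_leaf s hi
          obtain ⟨hlen, h₁, h₂⟩ := List.append_eq_replicate_iff.1 hw.symm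
          rcases Nat.eq_zero_or_pos w₂.length with h0 | h0
          · left
            rw [List.length_eq_zero_iff.1 h0, List.append_nil] at hw
            rw [← List.replicate_succ', hw, hrun]
          · right
            have : List.replicate n a = w₁ ++ List.replicate (w₂.length - 1) a := by
              rw [h₁, List.replicate_append_replicate]
              congr 1
              omega
            rw [this, List.append_assoc, run_append, run_append _ s w₁, hrun, periodic]
  have := key.run [b]
  rw [← run_append, ← run_append, h.run_exit p hp hpb] at this
  convert this using 1
  have split : List.replicate n a ++ List.replicate (m + 1) a ++ [b] =
      (List.replicate n a ++ [a]) ++ (List.replicate m a ++ [b]) := by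
    simp [List.replicate_succ]
  rw [split, run_append, exit, h.run_root_of_mem hb]

variable [Fintype A]

theorem exists_isTree_with_nodes [Fintype ι] (k : ι → ℕ) (hk : ∀ i, 0 < k i) (t : ℕ → ℕ)
    (t0 : t 0 = 1)
    (ht : ∀ l, t (l + 1) + (Finset.univ.filter fun i => k i = l + 1).card =
      Fintype.card A * t l)
    (tpos : ∀ l, 0 < t l ↔ ∃ i, l < k i) (m L : ℕ) (i₀ i₁ : ι) (hm : k i₀ = m + 1)
    (hmin : ∀ i, m + 1 ≤ k i) (hL : k i₁ = L) (hmax : ∀ i, k i ≤ L)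
    (y z s : List A) (hy : y.length = L) (hz : z.length = m + 1) (hs : s.length = m + 1)
    (hyz : y.take (m + 1) ≠ z) (hsz : s ≠ z) (hys : y.take (m + 1) = s ∨ 2 ≤ t (m + 1))
    (hmL : m + 1 < L) :
    ∃ (T : Set (List A)) (x : ι → List A), IsTree T x ∧ (∀ i, (x i).length = k i) ∧
      (∀ w ∈ T, w.length < L) ∧ z ∉ T ∧ s ∈ T ∧ (∀ l < L, y.take l ∈ T) ∧
      (∀ w, w.length ≤ m → w ∈ T) ∧ (t (m + 1) = 1 → ∀ w ∈ T, w.length = m + 1 → w = s) := by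
  classical
  have tfull (l : ℕ) (hl : l ≤ m) : t l = Fintype.card A ^ l := by
    induction l with
    | zero => simp [t0]
    | succ l ih =>
      have h1 := ht l
      rw [Finset.filter_false_of_mem fun i _ => by have := hmin i; omega, ih (by omega)] at h1
      simpa [pow_succ'] using h1
  let R (l : ℕ) : Finset (List A) :=
    (if l < L then {y.take l} else ∅) ∪ (if l = m + 1 then {s} else ∅)
  let F (l : ℕ) : Finset (List A) := if l = m + 1 then {z} else ∅
  have memR {l : ℕ} {r : List A} : r ∈ R l ↔ l < L ∧ r = y.take l ∨ l = m + 1 ∧ r = s := by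
    simp only [R, Finset.mem_union]
    split_ifs <;> simp_all
  have memF {l : ℕ} {r : List A} : r ∈ F l ↔ l = m + 1 ∧ r = z := by
    simp only [F]
    split_ifs <;> simp_all
  obtain ⟨S, S0, Slen, Scard, SR, Schild⟩ := exists_levels (A := A) t R F t0
    (fun l => by
      rw [← ht l]
      apply Nat.add_le_add_left
      by_cases hl : l = m
      · subst hl
        simp only [F, if_true, Finset.card_singleton]
        exact Finset.card_pos.2 ⟨i₀, by simpa using hm⟩
      · simp [F, hl])
    (fun l => by
      have hpos : l < L → 0 < t l := fun h => (tpos l).2 ⟨i₁, by omega⟩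
      by_cases hl : l = m + 1
      · subst hl
        simp only [R, if_true, if_pos hmL]
        rcases hys with hys | hys
        · rw [hys, Finset.union_self, Finset.card_singleton]
          exact hpos hmL
        · exact (Finset.card_union_le _ _).trans (by simpa using hys)
      · simp only [R, if_neg hl, Finset.union_empty]
        split_ifs with h
        · rw [Finset.card_singleton]
          exact hpos h
        · simp)
    (fun l r hr => by
      rw [memF]
      rcases memR.1 hr with ⟨h, rfl⟩ | ⟨rfl, rfl⟩
      · refine ⟨by simp; omega, ?_⟩
        rintro ⟨rfl, h'⟩
        exact hyz h'
      · exact ⟨hs, fun h' => hsz h'.2⟩)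
    (fun l r hr => by
      rcases memR.1 hr with ⟨h, rfl⟩ | ⟨h, rfl⟩
      · left
        rw [memR]
        left
        refine ⟨by omega, ?_⟩
        rw [List.dropLast_eq_take, List.take_take]
        simp
        omega
      · right
        exact tfull l (by omega))
  obtain ⟨x, hx, xlen⟩ := exists_isTree k hk t ht S S0 Slen Scard
    fun l => (Schild l).trans Finset.sdiff_subset
  refine ⟨_, x, hx, xlen, fun w hw => ?_, fun hzT => ?_, ?_, fun l hl => ?_, fun w hw => ?_,
    fun ht1 w hw hwl => ?_⟩
  · have : 0 < t w.length := by
      rw [← Scard]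
      exact Finset.card_pos.2 ⟨w, hw⟩
    obtain ⟨i, hi⟩ := (tpos _).1 this
    exact hi.trans_le (hmax i)
  · rw [Set.mem_ofPred_eq, hz] at hzT
    exact (Finset.mem_sdiff.1 (Schild m hzT)).2 (memF.2 ⟨rfl, rfl⟩)
  · rw [Set.mem_ofPred_eq, hs]
    exact SR _ (memR.2 (Or.inr ⟨rfl, rfl⟩))
  · rw [Set.mem_ofPred_eq, List.length_take, hy, min_eq_left hl.le]
    exact SR _ (memR.2 (Or.inl ⟨hl, rfl⟩))
  · have : S w.length = wordsOfLength A w.length := Finset.eq_of_subset_of_card_le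
      (fun w hw => mem_wordsOfLength.2 (Slen _ w hw)) (by rw [card_wordsOfLength, Scard, tfull _ hw])
    rw [Set.mem_ofPred_eq, this, mem_wordsOfLength]
  · rw [Set.mem_ofPred_eq, hwl] at hw
    exact Finset.card_le_one.1 ((Scard (m + 1)).trans ht1).le w hw s
      (SR _ (memR.2 (Or.inr ⟨rfl, rfl⟩)))

theorem exists_isTree_stable_root [Fintype ι] (k : ι → ℕ) (hk : ∀ i, 0 < k i)
    (hsum : ∑ i, ((Fintype.card A : ℚ) ^ k i)⁻¹ = 1) (hne : ∃ i j, k i ≠ k j) :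
    ∃ (T : Set (List A)) (x : ι → List A) (h : IsTree T x) (L : ℕ),
      (∀ i, (x i).length = k i) ∧ (∀ w ∈ T, w.length < L) ∧
      ∃ s : T, s.1 ≠ [] ∧ Stable h.step h.root s := by
  obtain ⟨i, j, hij⟩ := hne
  have hA := one_lt_card_of_kraft hk hsum hij
  obtain ⟨a, b, hab⟩ := Fintype.exists_pair_of_one_lt_card hA
  have : Nonempty A := ⟨a⟩
  have : Nonempty ι := ⟨i⟩
  obtain ⟨t, t0, ht, tpos⟩ := exists_inner_counts _ (by omega) k hk hsum
  obtain ⟨i₀, hi₀⟩ := Finite.exists_min k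
  obtain ⟨i₁, hi₁⟩ := Finite.exists_max k
  obtain ⟨m, hm⟩ : ∃ m, k i₀ = m + 1 := ⟨k i₀ - 1, by have := hk i₀; omega⟩
  obtain ⟨L, hL⟩ : ∃ L, k i₁ = L + 1 := ⟨k i₁ - 1, by have := hk i₁; omega⟩
  have hmL : m < L := by
    have := hi₀ i; have := hi₀ j; have := hi₁ i; have := hi₁ j
    omega
  have htm : 0 < t (m + 1) := (tpos _).2 ⟨i₁, by omega⟩
  have hsz : List.replicate m a ++ [b] ≠ List.replicate (m + 1) a := by
    simp [List.replicate_succ', hab.symm]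
  have fin {T : Set (List A)} (hT : ∀ w ∈ T, w.length < L + 1) : T.Finite :=
    (List.finite_length_lt A (L + 1)).subset hT
  by_cases hcase : m = 0 ∨ 2 ≤ t (m + 1)
  · obtain ⟨T, x, h, xlen, hTL, hz, hs, hy, hsmall, -⟩ := exists_isTree_with_nodes k hk t t0 ht tpos
      m (L + 1) i₀ i₁ hm (fun i => hm ▸ hi₀ i) hL (fun i => hL ▸ hi₁ i)
      (b :: List.replicate L a) (List.replicate (m + 1) a) (List.replicate m a ++ [b])
      (by simp) (by simp) (by simp) (by simp [List.replicate_succ, hab.symm]) hsz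
      (hcase.imp_left (by rintro rfl; simp)) (by omega)
    refine ⟨T, x, h, L + 1, xlen, hTL, ⟨_, hs⟩, by simp, ?_⟩
    have long {w : List A} (hw : w.length = L + 1) : w ∉ T := fun hT => by
      have := hTL w hT
      omega
    have hbT : [b] ∈ T := by simpa using hy 1 (by omega)
    refine h.stable_root hTL (fin hTL) a b m (L - 1) hz hs ⟨[b], hbT⟩ ?_ ?_ ?_ ?_
    · have := hy L (by omega)
      rwa [show L = L - 1 + 1 by omega, List.take_succ_cons, List.take_replicate,
        show min (L - 1) (L - 1 + 1) = L - 1 by omega] at this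
    · exact long (by simp; omega)
    · exact long (by simp; omega)
    · intro s _ hs0 hT
      have := hTL _ hT
      have := List.length_pos_iff.2 hs0
      simp at *
      omega
  · push Not at hcase
    obtain ⟨T, x, h, xlen, hTL, hz, hs, hy, hsmall, huniq⟩ :=
      exists_isTree_with_nodes k hk t t0 ht tpos
      m (L + 1) i₀ i₁ hm (fun i => hm ▸ hi₀ i) hL (fun i => hL ▸ hi₁ i)
      (List.replicate m a ++ [b] ++ List.replicate (L - m) a) (List.replicate (m + 1) a)
      (List.replicate m a ++ [b]) (by simp; omega) (by simp) (by simp)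
      (by rwa [List.take_left' (by simp)]) hsz (Or.inl (List.take_left' (by simp))) (by omega)
    have huniq := huniq (by omega)
    refine ⟨T, x, h, L + 1, xlen, hTL, ⟨_, hs⟩, by simp, ?_⟩
    have height (n : ℕ) (hn : L - m ≤ n + 1) (hn' : m ≤ n + 1) (s : List A) (hs0 : s ≠ []) :
        s ++ List.replicate (n + 1) a ∉ T := by
      intro hT
      have hpos := List.length_pos_iff.2 hs0
      have hlen := hTL _ hT
      simp only [List.length_append, List.length_replicate] at hlen
      have hpre : s ++ (List.replicate (m - s.length) a ++ [a]) <+: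
          s ++ List.replicate (n + 1) a := by
        rw [← List.replicate_succ']
        rw [List.prefix_append_right_inj]
        exact ⟨List.replicate (n - (m - s.length)) a, by
          rw [List.replicate_append_replicate]
          congr 1
          omega⟩
      have := huniq _ (h.of_prefix hpre hT) (by simp; omega)
      rw [← List.append_assoc] at this
      exact hab (by simpa using List.append_inj_right' this rfl)
    rcases le_total (L - m) m with hle | hle
    · obtain ⟨n, rfl⟩ : ∃ n, m = n + 1 := ⟨m - 1, by omega⟩
      have short {c : A} : [b] ++ (List.replicate n a ++ [c]) ∉ T := fun hT => by
        have := huniq _ hT (by simp)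
        simp [List.replicate_succ, hab.symm] at this
      exact h.stable_root hTL (fin hTL) a b (n + 1) n hz hs ⟨[b], hsmall _ (by simp)⟩
        (hsmall _ (by simp)) short short fun s _ => height n hle le_rfl s
    · have long {c : A} : List.replicate m a ++ [b] ++ (List.replicate (L - m - 1) a ++ [c]) ∉ T :=
        fun hT => by
          have := hTL _ hT
          simp at this
          omega
      refine h.stable_root hTL (fin hTL) a b m (L - m - 1) hz hs ⟨_, hs⟩ ?_ long long
        fun s _ => height _ (by omega) (by omega) s
      refine h.of_prefix ?_ (hy L (by omega))
      refine List.prefix_take_iff.2 ⟨?_, by simp; omega⟩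
      rw [List.prefix_append_right_inj]
      exact ⟨[a], by
        rw [← List.replicate_succ']
        congr 1
        omega⟩

end StableRoot

/-! ### Composition of prefix codes -/

section Composition

variable {A ι κ : Type*}

theorem mlift_cons (f : ι → List A) (i : ι) (l : List ι) :
    mlift f (i :: l) = f i ++ mlift f l := by
  simp [mlift]

theorem mlift_append (f : ι → List A) (l l' : List ι) :
    mlift f (l ++ l') = mlift f l ++ mlift f l' := by
  simp [mlift]

theorem mlift_mlift (f : κ → List A) (g : ι → List κ) (l : List ι) :
    mlift f (mlift g l) = mlift (fun i => mlift f (g i)) l := by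
  induction l with
  | nil => rfl
  | cons i l ih => rw [mlift_cons, mlift_append, ih, mlift_cons]

theorem length_mlift (f : ι → List A) (l : List ι) :
    (mlift f l).length = (l.map fun i => (f i).length).sum := by
  simp [mlift, Function.comp_def]

theorem prefix_of_mlift_prefix {f : ι → List A} (hf : ∀ i j, f i <+: f j → i = j)
    (hne : ∀ i, f i ≠ []) {l l' : List ι} (h : mlift f l <+: mlift f l') : l <+: l' := by
  induction l generalizing l' with
  | nil => exact List.nil_prefix
  | cons i l ih =>
    cases l' with
    | nil =>
      rw [mlift_cons] at h
      exact absurd (List.append_eq_nil_iff.1 (List.prefix_nil.1 h)).1 (hne i)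
    | cons j l' =>
      rw [mlift_cons, mlift_cons] at h
      have hij : i = j := by
        rcases List.prefix_or_prefix_of_prefix ((List.prefix_append _ _).trans h)
          (List.prefix_append _ _) with h' | h'
        · exact hf _ _ h'
        · exact (hf _ _ h').symm
      subst hij
      exact List.cons_prefix_cons.2 ⟨rfl, ih ((List.prefix_append_right_inj _).1 h)⟩

theorem mlift_injective {f : ι → List A} (hf : ∀ i j, f i <+: f j → i = j)
    (hne : ∀ i, f i ≠ []) : Function.Injective (mlift f) := fun l l' h =>
  have h₁ : l <+: l' := prefix_of_mlift_prefix hf hne (by rw [h])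
  h₁.eq_of_length_le (prefix_of_mlift_prefix hf hne (by rw [h]) : l' <+: l).length_le

theorem kraft_of_complete [Fintype A] [Nonempty A] [Fintype κ] (z : κ → List A)
    (hz : ∀ i j, z i <+: z j → i = j) (L : ℕ) (hL : ∀ j, (z j).length ≤ L)
    (hcomp : ∀ w : List A, w.length = L → ∃ j, z j <+: w) :
    ∑ j, ((Fintype.card A : ℚ) ^ (z j).length)⁻¹ = 1 := by
  classical
  let W (j : κ) : Finset (List A) := (wordsOfLength A (L - (z j).length)).image (z j ++ ·)
  have cardW (j : κ) : (W j).card = Fintype.card A ^ (L - (z j).length) := by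
    rw [Finset.card_image_of_injective _ (List.append_right_injective _), card_wordsOfLength]
  have disj : Set.PairwiseDisjoint ((Finset.univ : Finset κ) : Set κ) W := by
    intro i _ j _ hij
    refine Finset.disjoint_left.2 fun w hi hj => hij ?_
    obtain ⟨u, -, rfl⟩ := Finset.mem_image.1 hi
    obtain ⟨v, -, hv⟩ := Finset.mem_image.1 hj
    rcases List.prefix_or_prefix_of_prefix (List.prefix_append (z i) u)
      (hv ▸ List.prefix_append (z j) v) with h | h
    · exact hz _ _ h
    · exact (hz _ _ h).symm
  have union : Finset.univ.biUnion W = wordsOfLength A L := by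
    ext w
    simp only [Finset.mem_biUnion, Finset.mem_univ, true_and, W, Finset.mem_image,
      mem_wordsOfLength]
    constructor
    · rintro ⟨j, u, hu, rfl⟩
      have := hL j
      simp
      omega
    · intro hw
      obtain ⟨j, u, rfl⟩ := hcomp w hw
      exact ⟨j, u, by simp at hw; omega, rfl⟩
  have count : ∑ j, Fintype.card A ^ (L - (z j).length) = Fintype.card A ^ L := by
    rw [← card_wordsOfLength, ← union, Finset.card_biUnion disj]
    exact Finset.sum_congr rfl fun j _ => (cardW j).symm
  have hA : (Fintype.card A : ℚ) ≠ 0 := by exact_mod_cast Fintype.card_ne_zero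
  have hpow := pow_ne_zero L hA
  apply mul_left_cancel₀ hpow
  rw [mul_one, Finset.mul_sum]
  have countQ : ∑ j, (Fintype.card A : ℚ) ^ (L - (z j).length) = (Fintype.card A : ℚ) ^ L := by
    exact_mod_cast count
  refine Eq.trans (Finset.sum_congr rfl fun j _ => ?_) countQ
  rw [← pow_sub₀ _ hA (hL j)]

/-- The nonempty elements of `M` without proper nonempty prefixes in `M`. -/
def prefixBase (M : Set (List A)) : Set (List A) :=
  {u | u ∈ M ∧ u ≠ [] ∧ ∀ v ∈ M, v <+: u → v ≠ [] → v = u}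

theorem prefixBase_eq_of_prefix {M : Set (List A)} (u v : prefixBase M) (h : u.1 <+: v.1) :
    u = v :=
  Subtype.ext (v.2.2.2 _ u.2.1 h u.2.2.1)

theorem exists_prefixBase_prefix {M : Set (List A)} (w : List A) (hw : w ∈ M) (hne : w ≠ []) :
    ∃ u : prefixBase M, u.1 <+: w := by
  induction hn : w.length using Nat.strong_induction_on generalizing w with
  | _ n ih =>
    by_cases hmin : ∀ v ∈ M, v <+: w → v ≠ [] → v = w
    · exact ⟨⟨w, hw, hne, hmin⟩, List.prefix_rfl⟩
    · push Not at hmin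
      obtain ⟨v, hv, hvw, hv0, hne'⟩ := hmin
      have : v.length < w.length := lt_of_le_of_ne hvw.length_le
        fun h => hne' (hvw.eq_of_length h)
      obtain ⟨u, hu⟩ := ih v.length (hn ▸ this) v hv hv0 rfl
      exact ⟨u, hu.trans hvw⟩

theorem exists_prefixBase_factorization {M : Set (List A)}
    (hM : ∀ u v, u ∈ M → u ++ v ∈ M → v ∈ M) (w : List A) (hw : w ∈ M) :
    ∃ l : List (prefixBase M), mlift (·.1) l = w := by
  induction hn : w.length using Nat.strong_induction_on generalizing w with
  | _ n ih =>
    by_cases hne : w = []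
    · exact ⟨[], hne.symm⟩
    · obtain ⟨u, v, rfl⟩ := exists_prefixBase_prefix w hw hne
      have := List.length_pos_iff.2 u.2.2.1
      obtain ⟨l, hl⟩ := ih v.length (by simp at hn; omega) v (hM _ _ u.2.1 hw) rfl
      exact ⟨u :: l, by rw [mlift_cons, hl]⟩

end Composition

/-! ### The main result -/

section Main

variable {A : Type}

/-- Words of equal lengths `1` are the letters of the alphabet. -/
theorem exists_sync_of_length_one [Fintype A] [Nonempty A] {ι : Type} [Fintype ι]
    (hsum : ∑ _i : ι, ((Fintype.card A : ℚ) ^ 1)⁻¹ = 1) :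
    ∃ x : ι → List A, (∀ i, (x i).length = 1) ∧ (∀ i j, x i <+: x j → i = j) ∧
      ∃ w, ∀ u, ∃ l, mlift x l = u ++ w := by
  have hA : (Fintype.card A : ℚ) ≠ 0 := by exact_mod_cast Fintype.card_ne_zero
  have hcard : Fintype.card ι = Fintype.card A := by
    rw [Finset.sum_const, Finset.card_univ, nsmul_eq_mul, pow_one] at hsum
    field_simp at hsum
    exact_mod_cast hsum
  let e := Fintype.equivOfCardEq hcard
  refine ⟨fun i => [e i], fun i => rfl, fun i j h => ?_, [], fun u => ⟨u.map e.symm, ?_⟩⟩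
  · simpa using h
  · induction u with
    | nil => rfl
    | cons a u ih => simpa [mlift_cons] using ih

/-- The words that lead from the root to a state stable with the root. -/
def IsTree.stableWords {ι : Type*} {T : Set (List A)} {x : ι → List A} (h : IsTree T x) :
    Set (List A) :=
  {u | Stable h.step h.root (run h.step h.root u)}

section StableWords

variable {ι : Type*} {T : Set (List A)} {x : ι → List A} (h : IsTree T x)

theorem IsTree.append_mem_stableWords {u v : List A} (hu : u ∈ h.stableWords)
    (hv : v ∈ h.stableWords) : u ++ v ∈ h.stableWords := by
  have : Stable _ _ _ := (Stable.trans hv (Stable.run hu v))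
  rwa [← run_append] at this

theorem IsTree.of_append_mem_stableWords (u v : List A) (hu : u ∈ h.stableWords)
    (huv : u ++ v ∈ h.stableWords) : v ∈ h.stableWords := by
  have : Stable _ _ _ := Stable.run hu v
  rw [← run_append] at this
  exact Stable.trans huv this.symm

theorem IsTree.leaf_mem_stableWords (i : ι) : x i ∈ h.stableWords := by
  change Stable _ _ _
  rw [h.run_root_leaf]
  exact Stable.refl _ _

theorem IsTree.mlift_mem_stableWords (l : List (prefixBase h.stableWords)) :
    mlift (·.1) l ∈ h.stableWords := by
  induction l with
  | nil => exact Stable.refl _ _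
  | cons u l ih =>
    rw [mlift_cons]
    exact h.append_mem_stableWords u.2.1 ih

/-- Some word of stable return to the root sends all stable words to the root. -/
theorem IsTree.exists_reset [Nonempty A] {N : ℕ} (hN : ∀ w ∈ T, w.length < N) (fin : T.Finite) :
    ∃ v ∈ h.stableWords, ∀ u ∈ h.stableWords, run h.step h.root (u ++ v) = h.root := by
  classical
  have := fin.fintype
  obtain ⟨v, hv⟩ := exists_merging_word h.step h.root
    (Finset.univ.filter fun q => Stable h.step q h.root) (by simp)
  obtain ⟨v', hv'⟩ := h.connected hN (run h.step h.root v) h.root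
  refine ⟨v ++ v', ?_, fun u hu => ?_⟩
  · change Stable _ _ _
    rw [run_append, hv']
    exact Stable.refl _ _
  · rw [run_append, run_append, hv _ (by simpa using Stable.symm hu), hv']

theorem IsTree.base_mem_or_eq_leaf (u : prefixBase h.stableWords) :
    u.1 ∈ T ∨ ∃ i, x i = u.1 := by
  rcases h.mem_or_leaf_prefix h.nil_mem u.1 with hT | ⟨w₁, w₂, i, hw, hi⟩
  · exact Or.inl hT
  · exact Or.inr ⟨i, u.2.2.2 _ (h.leaf_mem_stableWords i) ⟨w₂, by rw [hw, ← hi]; rfl⟩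
      (h.leaf_ne_nil i)⟩

/-- If a node other than the root is stable with the root, then the base of the submonoid of
stable words is smaller than the set of leaves. -/
theorem IsTree.card_base_lt [Nontrivial A] [Fintype ι] [Fintype (prefixBase h.stableWords)]
    {N : ℕ} (hN : ∀ w ∈ T, w.length < N) (s : T) (hs : s.1 ≠ [])
    (hstable : Stable h.step h.root s) :
    Fintype.card (prefixBase h.stableWords) < Fintype.card ι := by
  have hpre (i : ι) := exists_prefixBase_prefix (x i) (h.leaf_mem_stableWords i) (h.leaf_ne_nil i)
  choose g hg using hpre
  have g_eq (i : ι) (u : prefixBase h.stableWords) (hu : u.1 <+: x i) : g i = u := by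
    rcases List.prefix_or_prefix_of_prefix (hg i) hu with h' | h'
    · exact prefixBase_eq_of_prefix _ _ h'
    · exact (prefixBase_eq_of_prefix _ _ h').symm
  have extend {w : List A} (hw : w ∈ T) (c : A) : ∃ i, w ++ [c] <+: x i := by
    by_cases hc : w ++ [c] ∈ T
    · obtain ⟨i, v, hv⟩ := h.exists_leaf_extending hN hc
      exact ⟨i, v, hv⟩
    · obtain ⟨i, hi⟩ := h.exists_leaf w hw c hc
      exact ⟨i, by rw [hi]⟩
  have surj : Function.Surjective g := fun u => by
    rcases h.base_mem_or_eq_leaf u with hu | ⟨i, hi⟩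
    · obtain ⟨i, v, hv⟩ := h.exists_leaf_extending hN hu
      exact ⟨i, g_eq i u ⟨v, hv⟩⟩
    · exact ⟨i, g_eq i u (by rw [hi])⟩
  refine Fintype.card_lt_of_surjective_not_injective g surj fun inj => ?_
  have hsM : s.1 ∈ h.stableWords := by
    change Stable _ _ _
    rwa [h.run_root_of_mem s.2]
  obtain ⟨u, hu⟩ := exists_prefixBase_prefix s.1 hsM hs
  have huT := h.of_prefix hu s.2
  obtain ⟨a, b, hab⟩ := exists_pair_ne A
  obtain ⟨i, hi⟩ := extend huT a
  obtain ⟨j, hj⟩ := extend huT b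
  have hij : i = j := inj <| by
    rw [g_eq i u ((List.prefix_append _ _).trans hi), g_eq j u ((List.prefix_append _ _).trans hj)]
  subst hij
  rcases List.prefix_or_prefix_of_prefix hi hj with h' | h'
  · exact hab (by simpa [List.prefix_append_right_inj] using h')
  · exact hab (by simpa [List.prefix_append_right_inj, eq_comm] using h')

end StableWords

theorem exists_sync_prefix_code [Fintype A] [Nonempty A] {ι : Type} [Fintype ι] (k : ι → ℕ)
    (hk : ∀ i, 0 < k i) (hgcd : ∀ g, (∀ i, g ∣ k i) → g = 1)
    (hsum : ∑ i, ((Fintype.card A : ℚ) ^ k i)⁻¹ = 1) :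
    ∃ x : ι → List A, (∀ i, (x i).length = k i) ∧ (∀ i j, x i <+: x j → i = j) ∧
      ∃ w, ∀ u, ∃ l, mlift x l = u ++ w := by
  classical
  induction hn : Fintype.card ι using Nat.strong_induction_on generalizing ι with
  | _ n ih =>
  by_cases hne : ∃ i j, k i ≠ k j
  · have hA : 1 < Fintype.card A := by
      obtain ⟨i, j, hij⟩ := hne
      exact one_lt_card_of_kraft hk hsum hij
    have : Nontrivial A := Fintype.one_lt_card_iff_nontrivial.1 hA
    obtain ⟨T, x, h, L, xlen, hL, s, hs, hstable⟩ := exists_isTree_stable_root k hk hsum hne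
    have fin : T.Finite := (List.finite_length_lt A L).subset hL
    have xle (i : ι) : (x i).length ≤ L := by
      obtain ⟨w, hw, a, hx⟩ := h.leaf i
      have := hL w hw
      simp [hx]
      omega
    have zle (u : prefixBase h.stableWords) : u.1.length ≤ L := by
      rcases h.base_mem_or_eq_leaf u with hu | ⟨i, hi⟩
      · exact (hL _ hu).le
      · exact hi ▸ xle i
    have finZ : (prefixBase h.stableWords).Finite :=
      (List.finite_length_le A L).subset fun u hu => zle ⟨u, hu⟩
    have := finZ.fintype
    choose l hl using fun i =>
      exists_prefixBase_factorization h.of_append_mem_stableWords (x i) (h.leaf_mem_stableWords i)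
    have hnonempty (u : prefixBase h.stableWords) : u.1 ≠ [] := u.2.2.1
    obtain ⟨z, zlen, zpre, w, hw⟩ := ih _ (hn ▸ h.card_base_lt hL s hs hstable)
      (fun u : prefixBase h.stableWords => u.1.length)
      (fun u => List.length_pos_iff.2 (hnonempty u))
      (fun g hg => hgcd g fun i => by
        rw [← xlen, ← hl, length_mlift]
        refine List.dvd_sum fun m hm => ?_
        obtain ⟨u, -, rfl⟩ := List.mem_map.1 hm
        exact hg u)
      (kraft_of_complete _ prefixBase_eq_of_prefix L zle fun w hw => by
        rcases h.mem_or_leaf_prefix h.nil_mem w with hT | ⟨w₁, w₂, i, rfl, hi⟩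
        · have := hL _ hT
          simp [hw] at this
        · obtain ⟨u, hu⟩ := exists_prefixBase_prefix (x i) (h.leaf_mem_stableWords i)
            (h.leaf_ne_nil i)
          refine ⟨u, hu.trans ?_⟩
          rw [← hi]
          exact List.prefix_append _ _)
      rfl
    have zne (u : prefixBase h.stableWords) : z u ≠ [] := fun hu => by
      have := zlen u
      rw [hu] at this
      exact hnonempty u (List.length_eq_zero_iff.1 this.symm)
    obtain ⟨v, hvM, hv⟩ := h.exists_reset hL fin
    obtain ⟨lv, hlv⟩ := exists_prefixBase_factorization h.of_append_mem_stableWords v hvM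
    refine ⟨fun i => mlift z (l i), fun i => ?_, fun i j hij => ?_, w ++ mlift z lv, fun u => ?_⟩
    · rw [← xlen i, ← hl i, length_mlift, length_mlift]
      simp only [zlen]
    · obtain ⟨r, hr⟩ := prefix_of_mlift_prefix zpre zne hij
      refine h.eq_of_prefix ⟨mlift (·.1) r, ?_⟩
      rw [← hl i, ← hl j, ← hr, mlift_append]
    · obtain ⟨lu, hlu⟩ := hw u
      obtain ⟨js, hjs⟩ := h.exists_factorization (mlift (·.1) lu ++ v)
        (hv _ (h.mlift_mem_stableWords lu))
      refine ⟨js, ?_⟩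
      have : mlift l js = lu ++ lv := by
        apply mlift_injective prefixBase_eq_of_prefix hnonempty
        rw [mlift_mlift, mlift_append, hlv, ← hjs]
        simp only [hl]
      rw [← mlift_mlift, this, mlift_append, hlu, List.append_assoc]
  · push Not at hne
    have hone (i : ι) : k i = 1 := hgcd (k i) fun j => (hne i j).dvd
    simp only [hone] at hsum ⊢
    exact exists_sync_of_length_one hsum

theorem mem_Kstar_range_iff {A ι : Type*} (x : ι → List A) (w : List A) :
    w ∈ Kstar (Set.range x) ↔ ∃ l, mlift x l = w := by
  constructor
  · rintro ⟨L, hL, rfl⟩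
    induction L with
    | nil => exact ⟨[], rfl⟩
    | cons y L ih =>
      obtain ⟨l, hl⟩ := ih fun y hy => hL y (List.mem_cons_of_mem _ hy)
      obtain ⟨i, rfl⟩ := hL y List.mem_cons_self
      exact ⟨i :: l, by rw [mlift_cons, hl, List.flatten_cons]⟩
  · rintro ⟨l, rfl⟩
    exact ⟨l.map x, by simp, rfl⟩

end Main

/-- If `gcd (k₁, …, kₙ) = 1` and `∑ d ^ (-kᵢ) = 1`, then `k₁, …, kₙ` are the code-word
lengths of a synchronizing complete prefix code over a `d`-letter alphabet. -/
theorem exists_sync_complete_prefix_code (n d : ℕ) (hn : 0 < n) (hd : 0 < d)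
    (k : Fin n → ℕ) (hk : ∀ i, 0 < k i)
    (hgcd : Finset.univ.gcd k = 1)
    (hsum : ∑ i : Fin n, ((d : ℚ) ^ k i)⁻¹ = 1) :
    ∃ x : Fin n → List (Fin d), Function.Injective x ∧ (∀ i, (x i).length = k i) ∧
      IsPrefixCode (Set.range x) ∧ IsCompleteSet (Set.range x) ∧
      IsSynchronizing (Set.range x) := by
  have : Nonempty (Fin d) := ⟨⟨0, hd⟩⟩
  obtain ⟨x, xlen, xpre, w, hw⟩ := exists_sync_prefix_code (A := Fin d) k hk
    (fun g hg => Nat.dvd_one.1 (hgcd ▸ Finset.dvd_gcd fun i _ => hg i))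
    (by rwa [Fintype.card_fin])
  have xne (i : Fin n) : x i ≠ [] := fun h => by
    have := xlen i
    rw [h] at this
    exact (hk i).ne this
  have right_unitary {u v : List (Fin d)} (hu : u ∈ Kstar (Set.range x))
      (huv : u ++ v ∈ Kstar (Set.range x)) : v ∈ Kstar (Set.range x) := by
    rw [mem_Kstar_range_iff] at *
    obtain ⟨l, rfl⟩ := hu
    obtain ⟨l', hl'⟩ := huv
    obtain ⟨r, rfl⟩ := prefix_of_mlift_prefix xpre xne ⟨v, hl'.symm⟩
    rw [mlift_append] at hl'
    exact ⟨r, List.append_cancel_left hl'⟩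
  have reset (u : List (Fin d)) : u ++ w ∈ Kstar (Set.range x) :=
    (mem_Kstar_range_iff x _).2 (hw u)
  refine ⟨x, fun i j h => xpre i j (by rw [h]), xlen, ⟨?_, fun h => ?_⟩,
    fun u => ⟨[], w, by simpa using reset u⟩, w, [], reset [], ⟨[], by simp⟩, fun r s h => ?_⟩
  · rintro _ ⟨i, rfl⟩ _ ⟨j, rfl⟩ h
    rw [xpre i j h]
  · have : x ⟨0, hn⟩ ∈ Set.range x := ⟨_, rfl⟩
    rw [h] at this
    exact xne _ this
  · exact ⟨reset r, right_unitary (reset r) (by simpa using h)⟩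
end

section
/- Let A be a nonempty finite alphabet and let X ⊆ A* be a nonempty finite synchronizing complete code not containing the empty word. Then the greatest common divisor of the lengths of the words of X is 1. -/
/-- If `d` divides the length of every word of `X`, it divides the length of every word of `X*`. -/
theorem dvd_length_of_mem_kstar {A : Type*} {X : Set (List A)} {d : ℕ}
    (hd : ∀ x ∈ X, d ∣ x.length) {w : List A} (hw : w ∈ Kstar X) : d ∣ w.length := by
  obtain ⟨l, hl, rfl⟩ := hw
  rw [List.length_flatten]
  refine List.dvd_sum fun n hn => ?_
  obtain ⟨x, hx, rfl⟩ := List.mem_map.1 hn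
  exact hd x (hl x hx)

/-- For a synchronizing complete set over a nonempty alphabet, a common divisor of the lengths of
its words is `1`. -/
theorem eq_one_of_dvd_length_of_sync_complete {A : Type*} [Nonempty A] {X : Set (List A)} {d : ℕ}
    (hcomp : IsCompleteSet X) (hsync : IsSynchronizing X) (hd : ∀ x ∈ X, d ∣ x.length) :
    d = 1 := by
  obtain ⟨u, v, hu, hv, h⟩ := hsync
  obtain ⟨a⟩ := ‹Nonempty A›
  obtain ⟨r, s, hrs⟩ := hcomp (u ++ v ++ [a] ++ (u ++ v))
  have hru : d ∣ (r ++ u).length :=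
    dvd_length_of_mem_kstar hd (h r ([a] ++ (u ++ v) ++ s) (by simpa using hrs)).1
  have hruvau : d ∣ (r ++ (u ++ v ++ [a]) ++ u).length :=
    dvd_length_of_mem_kstar hd (h (r ++ (u ++ v ++ [a])) s (by simpa using hrs)).1
  have hsum := ((dvd_length_of_mem_kstar hd hv).add (dvd_length_of_mem_kstar hd hu)).add hru
  rw [← Nat.dvd_one, ← Nat.dvd_add_right hsum]
  convert hruvau using 1
  simp only [List.length_append, List.length_singleton]
  ring

/-- The code-word lengths of a finite synchronizing complete code have gcd `1`. -/
theorem gcd_lengths_eq_one_of_sync_complete_code {A : Type*} [Fintype A] [Nonempty A]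
    (X : Set (List A)) (hfin : X.Finite) (hne : X.Nonempty) (heps : ([] : List A) ∉ X)
    (hcode : IsCode X) (hcomp : IsCompleteSet X) (hsync : IsSynchronizing X) :
    hfin.toFinset.gcd List.length = 1 := by
  refine eq_one_of_dvd_length_of_sync_complete hcomp hsync fun x hx => ?_
  exact Finset.gcd_dvd (hfin.mem_toFinset.2 hx)
end

section
/- Let A be a finite alphabet with d letters and let X ⊆ A* be a finite complete synchronizing code all of whose words have length at most n (n ≥ 1). Let B be a finite alphabet with d+1 letters and let r be a positive integer such that every finite incomplete set Y ⊆ B* whose words all have length at most n has an incompletable word of length at most r. Then X has a synchronizing pair (u,v) with |u·v| ≤ 2r + 2n − 2. -/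
/-- The proper prefixes of the words of `X`. -/
def ProperPrefixes {A : Type*} (X : Set (List A)) : Set (List A) :=
  {p | ∃ t, t ≠ [] ∧ p ++ t ∈ X}

/-- `(p, q)` is either a pair of empty words or a proper splitting of a word of `X`. -/
def Straddles {A : Type*} (X : Set (List A)) (p q : List A) : Prop :=
  (p = [] ∧ q = []) ∨ (p ≠ [] ∧ q ≠ [] ∧ p ++ q ∈ X)

/-- The words over `B` that do not end with `b` and have image in `X`, together with the words
`p b` such that the image of `p` is a proper prefix of a word of `X` not belonging to `R`. -/
def markedSet {A B : Type*} (X R : Set (List A)) (f : B → A) (b : B) : Set (List B) :=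
  {y | (y.map f ∈ X ∧ ∀ p, y ≠ p ++ [b]) ∨
    ∃ p, y = p ++ [b] ∧ p.map f ∈ ProperPrefixes X ∧ p.map f ∉ R}

section Kstar

variable {A : Type*} {X : Set (List A)}

theorem nil_mem_Kstar : [] ∈ Kstar X := ⟨[], by simp, rfl⟩

theorem mem_Kstar_of_mem {x : List A} (hx : x ∈ X) : x ∈ Kstar X := ⟨[x], by simpa, by simp⟩

theorem append_mem_Kstar_s4 {u v : List A} (hu : u ∈ Kstar X) (hv : v ∈ Kstar X) :
    u ++ v ∈ Kstar X := by
  obtain ⟨l, hl, rfl⟩ := hu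
  obtain ⟨m, hm, rfl⟩ := hv
  refine ⟨l ++ m, fun x hx => ?_, by simp⟩
  rcases List.mem_append.1 hx with h | h
  exacts [hl x h, hm x h]

theorem Straddles.append_mem_Kstar {p q : List A} (h : Straddles X p q) : p ++ q ∈ Kstar X := by
  rcases h with ⟨rfl, rfl⟩ | ⟨-, -, h⟩
  exacts [nil_mem_Kstar, mem_Kstar_of_mem h]

theorem exists_straddles {g h : List A} (H : g ++ h ∈ Kstar X) :
    ∃ z p q z', z ∈ Kstar X ∧ z' ∈ Kstar X ∧ g = z ++ p ∧ h = q ++ z' ∧ Straddles X p q := by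
  obtain ⟨l, hl, hf⟩ := H
  induction l generalizing g with
  | nil =>
    simp only [List.flatten_nil, List.nil_eq, List.append_eq_nil_iff] at hf
    obtain ⟨rfl, rfl⟩ := hf
    exact ⟨[], [], [], [], nil_mem_Kstar, nil_mem_Kstar, rfl, rfl, Or.inl ⟨rfl, rfl⟩⟩
  | cons x l ih =>
    have hx : x ∈ X := hl x (by simp)
    have hl' : ∀ y ∈ l, y ∈ X := fun y hy => hl y (by simp [hy])
    rw [List.flatten_cons, List.append_eq_append_iff] at hf
    rcases hf with ⟨a, rfl, ha⟩ | ⟨q, rfl, rfl⟩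
    · obtain ⟨z, p, q, z', hz, hz', rfl, rfl, hs⟩ := ih hl' ha
      exact ⟨x ++ z, p, q, z', append_mem_Kstar_s4 (mem_Kstar_of_mem hx) hz, hz', by simp, rfl, hs⟩
    · by_cases hg : g = []
      · subst hg
        exact ⟨[], [], [], _, nil_mem_Kstar, append_mem_Kstar_s4 (mem_Kstar_of_mem hx) ⟨l, hl', rfl⟩,
          rfl, rfl, Or.inl ⟨rfl, rfl⟩⟩
      · by_cases hq : q = []
        · subst hq
          exact ⟨g, [], [], _, mem_Kstar_of_mem (by simpa using hx), ⟨l, hl', rfl⟩, by simp, rfl,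
            Or.inl ⟨rfl, rfl⟩⟩
        · exact ⟨[], g, q, _, nil_mem_Kstar, ⟨l, hl', rfl⟩, rfl, rfl, Or.inr ⟨hg, hq, hx⟩⟩

theorem exists_factor_covering {g h : List A} {c : A} (H : g ++ c :: h ∈ Kstar X) :
    ∃ z p q z', z ∈ Kstar X ∧ z' ∈ Kstar X ∧ g = z ++ p ∧ h = q ++ z' ∧ p ++ c :: q ∈ X := by
  obtain ⟨l, hl, hf⟩ := H
  induction l generalizing g with
  | nil => simp at hf
  | cons x l ih =>
    have hx : x ∈ X := hl x (by simp)
    have hl' : ∀ y ∈ l, y ∈ X := fun y hy => hl y (by simp [hy])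
    rw [List.flatten_cons, List.append_eq_append_iff] at hf
    rcases hf with ⟨a, rfl, ha⟩ | ⟨_ | ⟨d, q⟩, rfl, h2⟩
    · obtain ⟨z, p, q, z', hz, hz', rfl, rfl, hs⟩ := ih hl' ha
      exact ⟨x ++ z, p, q, z', append_mem_Kstar_s4 (mem_Kstar_of_mem hx) hz, hz', by simp, rfl, hs⟩
    · obtain ⟨z, p, q, z', hz, hz', e, rfl, hs⟩ := ih (g := []) hl' (by simpa using h2.symm)
      exact ⟨g ++ z, p, q, z', append_mem_Kstar_s4 (mem_Kstar_of_mem (by simpa using hx)) hz, hz',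
        by simp [← e], rfl, hs⟩
    · obtain ⟨rfl, rfl⟩ := List.cons.inj h2
      exact ⟨[], g, q, _, nil_mem_Kstar, ⟨l, hl', rfl⟩, rfl, rfl, hx⟩

theorem IsCode.mem_Kstar_of_stable (hX : IsCode X) {z t q : List A} (hz : z ∈ Kstar X)
    (hzt : z ++ t ∈ Kstar X) (htq : t ++ q ∈ Kstar X) (hq : q ∈ Kstar X) : t ∈ Kstar X := by
  obtain ⟨l, hl, rfl⟩ := hz
  obtain ⟨m, hm, hmt⟩ := hzt
  obtain ⟨k, hk, hkq⟩ := htq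
  obtain ⟨j, hj, rfl⟩ := hq
  have key := hX (l ++ k) (m ++ j) (by simpa [or_imp, forall_and] using ⟨hl, hk⟩)
    (by simpa [or_imp, forall_and] using ⟨hm, hj⟩) (by simp [hmt, hkq])
  rcases List.append_eq_append_iff.1 key with ⟨a, rfl, rfl⟩ | ⟨c, rfl, rfl⟩
  · refine ⟨a, fun x hx => hk x (by simp [hx]), ?_⟩
    simpa using hmt
  · have h := congrArg List.length hmt
    simp only [List.flatten_append, List.length_append] at h
    have : t = [] := List.length_eq_zero_iff.1 (by omega)
    exact this ▸ nil_mem_Kstar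

theorem IsCode.head_eq (hX : IsCode X) {x y z w : List A} (hx : x ∈ X) (hy : y ∈ X)
    (hz : z ∈ Kstar X) (hw : w ∈ Kstar X) (h : x ++ z = y ++ w) : x = y := by
  obtain ⟨l, hl, rfl⟩ := hz
  obtain ⟨m, hm, rfl⟩ := hw
  have := hX (x :: l) (y :: m) (by simpa using ⟨hx, hl⟩) (by simpa using ⟨hy, hm⟩) (by simpa using h)
  simpa using (List.cons.inj this).1

theorem IsCode.eq_nil_of_straddles (hX : IsCode X) {z t p q z' p' q' y' : List A}
    (hz : z ∈ Kstar X) (hz' : z' ∈ Kstar X) (hy : z ++ t ∈ Kstar X) (hy' : y' ∈ Kstar X)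
    (hs : Straddles X p q) (hs' : Straddles X p' q') (hp : p = t ++ p')
    (hq : q ++ z' = q' ++ y') : t = [] := by
  have e : t ++ (p' ++ q' ++ y') = p ++ q ++ z' := by
    rw [hp]; simp [hq]
  have hm : p' ++ q' ++ y' ∈ Kstar X := append_mem_Kstar_s4 hs'.append_mem_Kstar hy'
  have ht : t ∈ Kstar X := hX.mem_Kstar_of_stable hz hy
    (e ▸ append_mem_Kstar_s4 hs.append_mem_Kstar hz') hm
  by_contra hne
  have hpne : p ≠ [] := by rw [hp]; simp [hne]
  rcases hs with ⟨rfl, -⟩ | ⟨-, hqne, hpq⟩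
  · exact hpne rfl
  obtain ⟨l, hl, rfl⟩ := ht
  cases l with
  | nil => exact hne rfl
  | cons x l =>
    have hx := hX.head_eq (hl x (by simp)) hpq
      (append_mem_Kstar_s4 ⟨l, fun y hy => hl y (by simp [hy]), rfl⟩ hm) hz' (by simpa using e)
    have h1 := congrArg List.length hx
    have h2 := congrArg List.length hp
    have h3 := List.length_pos_iff.2 hqne
    simp only [List.flatten_cons, List.length_append] at h1 h2
    omega

theorem IsCode.straddles_unique (hX : IsCode X) {z p q z' y p' q' y' : List A}
    (hz : z ∈ Kstar X) (hz' : z' ∈ Kstar X) (hy : y ∈ Kstar X) (hy' : y' ∈ Kstar X)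
    (hs : Straddles X p q) (hs' : Straddles X p' q') (hp : z ++ p = y ++ p')
    (hq : q ++ z' = q' ++ y') : p = p' ∧ q = q' := by
  have hpp : p = p' := by
    rcases List.append_eq_append_iff.1 hp with ⟨t, rfl, h⟩ | ⟨t, rfl, h⟩
    · have := hX.eq_nil_of_straddles hz hz' hy hy' hs hs' h hq
      simpa [this] using h
    · have := hX.eq_nil_of_straddles hy hy' hz hz' hs' hs h hq.symm
      simpa [this] using h.symm
  subst hpp
  refine ⟨rfl, ?_⟩
  rcases hs with ⟨rfl, rfl⟩ | ⟨h1, -, h3⟩ <;> rcases hs' with ⟨h1', h2'⟩ | ⟨h1', -, h3'⟩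
  · exact h2'.symm
  · exact absurd rfl h1'
  · exact absurd h1' h1
  · have := hX.head_eq h3 h3' hz' hy' (by simp [hq])
    simpa using this

theorem exists_short_completion {n : ℕ} (hlen : ∀ w ∈ X, w.length ≤ n) {w : List A}
    (hw : ∃ l s, l ++ w ++ s ∈ Kstar X) :
    ∃ l s : List A, l.length ≤ n - 1 ∧ s.length ≤ n - 1 ∧ l ++ w ++ s ∈ Kstar X := by
  obtain ⟨l, s, h⟩ := hw
  rw [List.append_assoc] at h
  obtain ⟨z, p, q, z', -, hz', -, e, hs⟩ := exists_straddles h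
  have h' : (p ++ w) ++ s ∈ Kstar X := by
    rw [List.append_assoc, e, ← List.append_assoc]
    exact append_mem_Kstar_s4 hs.append_mem_Kstar hz'
  obtain ⟨y, p', q', y', hy, -, e', -, hs'⟩ := exists_straddles h'
  refine ⟨p, q', ?_, ?_, ?_⟩
  · rcases hs with ⟨rfl, rfl⟩ | ⟨-, h2, h3⟩
    · simp
    · have := hlen _ h3
      have := List.length_pos_iff.2 h2
      simp only [List.length_append] at *
      omega
  · rcases hs' with ⟨rfl, rfl⟩ | ⟨h2, -, h3⟩
    · simp
    · have := hlen _ h3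
      have := List.length_pos_iff.2 h2
      simp only [List.length_append] at *
      omega
  · rw [e', List.append_assoc]
    exact append_mem_Kstar_s4 hy hs'.append_mem_Kstar

theorem exists_long_mem_Kstar {x : List A} (hx : x ∈ X) (hne : x ≠ []) (n : ℕ) :
    ∃ z ∈ Kstar X, n ≤ z.length := by
  induction n with
  | zero => exact ⟨[], nil_mem_Kstar, by simp⟩
  | succ n ih =>
    obtain ⟨z, hz, h⟩ := ih
    refine ⟨x ++ z, append_mem_Kstar_s4 (mem_Kstar_of_mem hx) hz, ?_⟩
    have := List.length_pos_iff.2 hne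
    simp only [List.length_append]
    omega

theorem IsSyncPair.append {u v z z' : List A} (h : IsSyncPair X u v) (hz : z ∈ Kstar X)
    (hz' : z' ∈ Kstar X) : IsSyncPair X (z ++ u) (v ++ z') := by
  refine ⟨append_mem_Kstar_s4 hz h.1, append_mem_Kstar_s4 h.2.1 hz', fun r s hrs => ?_⟩
  have := h.2.2 (r ++ z) (z' ++ s) (by simpa using hrs)
  simpa using this

end Kstar

section Reverse

variable {A : Type*} {X : Set (List A)}

theorem mem_Kstar_reverse {w : List A} :
    w ∈ Kstar (List.reverse ⁻¹' X) ↔ w.reverse ∈ Kstar X := by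
  have key : ∀ (Y : Set (List A)) (v : List A), v ∈ Kstar (List.reverse ⁻¹' Y) →
      v.reverse ∈ Kstar Y := by
    rintro Y _ ⟨l, hl, rfl⟩
    refine ⟨(l.map List.reverse).reverse, fun x hx => ?_, by rw [List.reverse_flatten]⟩
    simp only [List.mem_reverse, List.mem_map] at hx
    obtain ⟨y, hy, rfl⟩ := hx
    exact hl y hy
  refine ⟨key X w, fun h => ?_⟩
  have h' := key (List.reverse ⁻¹' X) w.reverse
    (by simpa [Set.preimage_preimage] using h)
  simpa using h'

theorem IsCompleteSet.reverse (hX : IsCompleteSet X) : IsCompleteSet (List.reverse ⁻¹' X) := by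
  intro w
  obtain ⟨r, s, h⟩ := hX w.reverse
  exact ⟨s.reverse, r.reverse, mem_Kstar_reverse.2 (by simpa using h)⟩

theorem IsSyncPair.reverse {u v : List A} (h : IsSyncPair X u v) :
    IsSyncPair (List.reverse ⁻¹' X) v.reverse u.reverse := by
  refine ⟨mem_Kstar_reverse.2 (by simpa using h.2.1), mem_Kstar_reverse.2 (by simpa using h.1),
    fun r s hrs => ?_⟩
  have := h.2.2 s.reverse r.reverse (by simpa using mem_Kstar_reverse.1 hrs)
  exact ⟨mem_Kstar_reverse.2 (by simpa using this.2), mem_Kstar_reverse.2 (by simpa using this.1)⟩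

theorem IsCode.reverse (hX : IsCode X) : IsCode (List.reverse ⁻¹' X) := by
  intro l m hl hm h
  have key := hX (l.map List.reverse).reverse (m.map List.reverse).reverse
    (fun x hx => by simpa using hl x.reverse (by simpa using hx))
    (fun x hx => by simpa using hm x.reverse (by simpa using hx))
    (by rw [← List.reverse_flatten, ← List.reverse_flatten, h])
  exact List.map_injective_iff.2 List.reverse_injective (List.reverse_injective key)

end Reverse

section MarkedSet

variable {A B : Type*} {X R : Set (List A)} {f : B → A} {b : B}

theorem mem_of_mem_markedSet {p q : List B} (h : p ++ q ∈ markedSet X R f b) (hq : q ≠ [])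
    (hb : b ∉ q) : (p ++ q).map f ∈ X := by
  rcases h with ⟨h, -⟩ | ⟨p', h, -⟩
  · exact h
  · obtain ⟨q', c, rfl⟩ := List.eq_nil_or_concat' q |>.resolve_left hq
    rw [← List.append_assoc] at h
    have := (List.append_inj' h rfl).2
    simp_all

theorem map_mem_Kstar {z : List B} (h : z ∈ Kstar (markedSet X R f b))
    (hb : b ∉ z) : z.map f ∈ Kstar X := by
  obtain ⟨l, hl, rfl⟩ := h
  refine ⟨l.map (List.map f), fun x hx => ?_, by simp⟩
  obtain ⟨y, hy, rfl⟩ := List.mem_map.1 hx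
  have hby : b ∉ y := fun h => hb (List.mem_flatten.2 ⟨y, hy, h⟩)
  by_cases hne : y = []
  · subst hne
    rcases hl _ hy with ⟨h, -⟩ | ⟨p', h, -⟩
    · exact h
    · simp at h
  · exact mem_of_mem_markedSet (p := []) (hl y hy) hne hby

theorem exists_left_completion {r G : List B}
    (h : r ++ G ∈ Kstar (markedSet X R f b)) (hb : b ∉ G) : ∃ r', r' ++ G.map f ∈ Kstar X := by
  obtain ⟨z, p, q, z', -, hz', rfl, rfl, hs⟩ := exists_straddles h
  simp only [List.mem_append, not_or] at hb
  have h2 := map_mem_Kstar hz' hb.2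
  rcases hs with ⟨rfl, rfl⟩ | ⟨-, hq, hpq⟩
  · exact ⟨[], by simpa using h2⟩
  · refine ⟨p.map f, ?_⟩
    have := append_mem_Kstar_s4 (mem_Kstar_of_mem (mem_of_mem_markedSet hpq hq hb.1)) h2
    simpa using this

theorem exists_right_completion {s H : List B}
    (h : H ++ s ∈ Kstar (markedSet X R f b)) (hb : b ∉ H) : ∃ s', H.map f ++ s' ∈ Kstar X := by
  obtain ⟨z, p, q, z', hz, -, rfl, rfl, hs⟩ := exists_straddles h
  simp only [List.mem_append, not_or] at hb
  have h2 := map_mem_Kstar hz hb.1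
  rcases hs with ⟨rfl, rfl⟩ | ⟨-, hq, hpq⟩
  · exact ⟨[], by simpa using h2⟩
  · rcases hpq with ⟨hpq, -⟩ | ⟨p', hpq, ⟨t, -, ht⟩, -⟩
    · refine ⟨q.map f, ?_⟩
      have := append_mem_Kstar_s4 h2 (mem_Kstar_of_mem hpq)
      simpa using this
    · obtain ⟨q', c, rfl⟩ := List.eq_nil_or_concat' q |>.resolve_left hq
      rw [← List.append_assoc] at hpq
      obtain rfl := (List.append_inj' hpq rfl).1
      refine ⟨q'.map f ++ t, ?_⟩
      have := append_mem_Kstar_s4 h2 (mem_Kstar_of_mem ht)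
      simpa using this


theorem length_le_of_mem_markedSet {n : ℕ} (hlen : ∀ w ∈ X, w.length ≤ n) {y : List B}
    (hy : y ∈ markedSet X R f b) : y.length ≤ n := by
  rcases hy with ⟨h, -⟩ | ⟨p, rfl, ⟨t, ht, h⟩, -⟩
  · simpa using hlen _ h
  · have := hlen _ h
    have := List.length_pos_iff.2 ht
    simp only [List.length_append, List.length_map, List.length_singleton] at *
    omega

theorem exists_lift_of_prefix {g : A → B} (hfg : ∀ x, f (g x) = x) (w : List B)
    (hw : ∀ w₁ w₂, w = w₁ ++ b :: w₂ → ∃ l z p, z ∈ Kstar X ∧ p ∈ ProperPrefixes X ∧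
      l ++ w₁.map f = z ++ p ∧ p ∉ R)
    {l z p : List A} (hz : z ∈ Kstar X) (hp : p ∈ ProperPrefixes X)
    (h : l ++ w.map f = z ++ p) :
    ∃ l' z' p', z' ∈ Kstar (markedSet X R f b) ∧ l' ++ w = z' ++ p' ∧ p'.map f = p := by
  induction hN : w.length using Nat.strong_induction_on generalizing w l z p with
  | _ N ih =>
    subst hN
    have hmap : ∀ c : List A, (c.map g).map f = c := fun c => by
      simp [Function.comp_def, hfg]
    rcases List.append_eq_append_iff.1 h with ⟨a, rfl, h2⟩ | ⟨c, rfl, rfl⟩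
    · obtain ⟨w₁, q, rfl, rfl, rfl⟩ := List.map_eq_append_iff.1 h2
      obtain rfl | ⟨w₂, c, rfl⟩ := List.eq_nil_or_concat' w₁
      · exact ⟨[], [], q, nil_mem_Kstar, rfl, rfl⟩
      · have hw₂ : ∀ u v, w₂ = u ++ b :: v → ∃ l z p, z ∈ Kstar X ∧ p ∈ ProperPrefixes X ∧
            l ++ u.map f = z ++ p ∧ p ∉ R := fun u v huv =>
          hw u (v ++ [c] ++ q) (by simp [huv])
        have hlt : w₂.length < (w₂ ++ [c] ++ q).length := by simp
        by_cases hc : c = b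
        · subst hc
          obtain ⟨l₃, z₃, p₃, hz₃, hp₃, e₃, hR⟩ := hw w₂ q (by simp)
          obtain ⟨l', z', p', hz', e', rfl⟩ := ih _ hlt w₂ hw₂ hz₃ hp₃ e₃ rfl
          refine ⟨l', z' ++ (p' ++ [c]), q, append_mem_Kstar_s4 hz' (mem_Kstar_of_mem
            (Or.inr ⟨p', rfl, hp₃, hR⟩)), ?_, rfl⟩
          simp only [← List.append_assoc, e']
        · obtain ⟨z₁, x', q₁, z₁', hz₁, -, e₁, e₂, hx⟩ := exists_factor_covering (X := X)
            (g := l ++ w₂.map f) (c := f c) (h := []) (by simpa using hz)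
          obtain ⟨rfl, -⟩ := List.append_eq_nil_iff.1 e₂.symm
          obtain ⟨l', z', p', hz', e', rfl⟩ := ih _ hlt w₂ hw₂ hz₁ ⟨[f c], by simp, hx⟩ e₁ rfl
          refine ⟨l', z' ++ (p' ++ [c]), q, append_mem_Kstar_s4 hz' (mem_Kstar_of_mem
            (Or.inl ⟨by simpa using hx, fun p h => hc ?_⟩)), ?_, rfl⟩
          · simpa using (List.append_inj' h rfl).2
          · simp only [← List.append_assoc, e']
    · exact ⟨c.map g, [], c.map g ++ w, nil_mem_Kstar, rfl, by rw [List.map_append, hmap]⟩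

theorem not_isCompleteSet_markedSet (hX : IsCode X) {n : ℕ} (hlen : ∀ w ∈ X, w.length ≤ n)
    {u v p₀ : List A} (hsync : IsSyncPair X u v) (hv : n ≤ v.length)
    (hx : p₀ ++ [f b] ∈ X) {g : A → B} (hfg : ∀ x, f (g x) = x) (hgb : ∀ x, g x ≠ b) :
    ¬ IsCompleteSet (markedSet X {p | ∃ z ∈ Kstar X, z ++ p = v ++ p₀} f b) := by
  intro hcomp
  have hmap : ∀ c : List A, (c.map g).map f = c := fun c => by
    simp [Function.comp_def, hfg]
  have hbmap : ∀ c : List A, b ∉ c.map g := fun c hc => by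
    obtain ⟨x, -, hx⟩ := List.mem_map.1 hc
    exact hgb x hx
  obtain ⟨r, s, h⟩ := hcomp ((u ++ v ++ p₀).map g ++ b :: (u ++ v).map g)
  have hG := hmap (u ++ v ++ p₀)
  have hbG := hbmap (u ++ v ++ p₀)
  have hGlen : n ≤ ((u ++ v ++ p₀).map g).length := by simp; omega
  have hH := hmap (u ++ v)
  have hbH := hbmap (u ++ v)
  have hHlen : n ≤ ((u ++ v).map g).length := by simp; omega
  generalize (u ++ v ++ p₀).map g = G at *
  generalize (u ++ v).map g = H at *
  obtain ⟨z, p, q, z', hz, hz', e₁, e₂, hy⟩ := exists_factor_covering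
    (g := r ++ G) (c := b) (h := H ++ s) (by simpa using h)
  have hylen := length_le_of_mem_markedSet hlen hy
  simp only [List.length_append, List.length_cons] at hylen
  obtain ⟨G', rfl⟩ : p <:+ G := List.suffix_of_suffix_length_le (l₃ := r ++ G)
    ⟨z, e₁.symm⟩ ⟨r, rfl⟩ (by omega)
  obtain ⟨H', rfl⟩ : q <+: H := List.prefix_of_prefix_length_le (l₃ := H ++ s)
    ⟨z', e₂.symm⟩ ⟨s, rfl⟩ (by omega)
  obtain rfl : z = r ++ G' := by
    rw [← List.append_assoc] at e₁
    exact (List.append_cancel_right e₁).symm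
  obtain rfl : H' ++ s = z' := by
    rw [List.append_assoc] at e₂
    exact List.append_cancel_left e₂
  simp only [List.mem_append, not_or] at hbG hbH
  obtain ⟨r', hr'⟩ := exists_left_completion hz hbG.1
  obtain ⟨s', hs'⟩ := exists_right_completion hz' hbH.2
  obtain ⟨t, ht⟩ : p.map f ∈ ProperPrefixes X := by
    rcases hy with ⟨h, -⟩ | ⟨p', h, hp', -⟩
    · exact ⟨f b :: q.map f, by simp, by simpa using h⟩
    · obtain rfl | ⟨q', c, rfl⟩ := List.eq_nil_or_concat' q
      · obtain rfl := (List.append_inj' h rfl).1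
        exact hp'
      · have := (List.append_inj' (s₁ := p ++ b :: q') (t₁ := [c]) (s₂ := p') (t₂ := [b])
          (by simpa using h) rfl).2
        simp_all
  rw [List.map_append] at hG hH
  have hsync₁ := hsync.2.2 r' (p₀ ++ t) (by
    have : r' ++ (u ++ v) ++ (p₀ ++ t) = r' ++ (u ++ v ++ p₀) ++ t := by simp
    rw [this, ← hG]
    simpa using append_mem_Kstar_s4 hr' (mem_Kstar_of_mem ht.2))
  have hpR : ∃ z ∈ Kstar X, z ++ p.map f = v ++ p₀ := by
    obtain ⟨t', ht'⟩ : p.map f <:+ v ++ p₀ := List.suffix_of_suffix_length_le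
      (l₃ := u ++ v ++ p₀) ⟨_, hG⟩ ⟨u, by simp⟩ (by simp; omega)
    have hG' : G'.map f = u ++ t' := by
      rw [List.append_assoc, ← ht', ← List.append_assoc] at hG
      exact List.append_cancel_right hG
    refine ⟨t', hX.mem_Kstar_of_stable hsync₁.1 (q := p.map f ++ t) ?_ ?_
      (mem_Kstar_of_mem ht.2), ht'⟩
    · rw [List.append_assoc, ← hG']
      exact hr'
    · rw [← List.append_assoc, ht', List.append_assoc]
      exact hsync₁.2
  by_cases hq : q = []
  · subst hq
    rcases hy with ⟨-, h⟩ | ⟨p', h, -, hp'⟩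
    · exact h p rfl
    · obtain rfl := (List.append_inj' h rfl).1
      exact hp' hpR
  · have hyX := mem_of_mem_markedSet (p := p ++ [b]) (by simpa using hy) hq hbH.1
    have key : r' ++ u ++ v ++ p₀ ++ [f b] = (r' ++ G'.map f) ++ (p.map f ++ [f b]) := by
      have : r' ++ u ++ v ++ p₀ ++ [f b] = r' ++ (u ++ v ++ p₀) ++ [f b] := by simp
      rw [this, ← hG]
      simp
    have key₂ : u ++ v ++ s' = q.map f ++ (H'.map f ++ s') := by
      rw [← hH]
      simp
    have hs : Straddles X (p.map f ++ [f b]) (q.map f) :=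
      Or.inr ⟨by simp, by simpa using hq, by simpa using hyX⟩
    have hsync₂ := hsync.2.2 (r' ++ u ++ v ++ p₀ ++ [f b]) s' (by
      have := append_mem_Kstar_s4 (append_mem_Kstar_s4 hr' hs.append_mem_Kstar) hs'
      rw [List.append_assoc, key, key₂]
      simpa using this)
    have := hX.straddles_unique hr' hs' (y := r' ++ u ++ v ++ p₀ ++ [f b]) (y' := u ++ v ++ s')
      (p' := []) (q' := []) ?_ ?_ hs (Or.inl ⟨rfl, rfl⟩) (by simpa using key.symm)
      (by simpa using key₂.symm)
    · exact hq (by simpa using this.2)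
    · have := append_mem_Kstar_s4 (append_mem_Kstar_s4 hsync₁.1 hsync.2.1) (mem_Kstar_of_mem hx)
      simpa using this
    · have := append_mem_Kstar_s4 hsync.1 hsync₂.2
      simpa using this

end MarkedSet

theorem exists_left_resolving_word {A B : Type*} [Fintype A] [Fintype B] {n r : ℕ}
    (hcard : Fintype.card B = Fintype.card A + 1) {X : Set (List A)}
    (hlen : ∀ w ∈ X, w.length ≤ n) (hX : IsCode X) (hcomp : IsCompleteSet X)
    (hsync : IsSynchronizing X) (hne : ∃ x ∈ X, x ≠ [])
    (hR : ∀ Y : Set (List B), Y.Finite → (∀ w ∈ Y, w.length ≤ n) → ¬ IsCompleteSet Y →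
      ∃ w : List B, (∀ p s : List B, p ++ w ++ s ∉ Kstar Y) ∧ w.length ≤ r) :
    ∃ w c : List A, w.length + 1 ≤ r ∧ ∀ l z p, z ∈ Kstar X → p ∈ ProperPrefixes X →
      l ++ w = z ++ p → ∃ y ∈ Kstar X, y ++ p = c := by
  obtain ⟨x, hx, hxne⟩ := hne
  obtain ⟨z, hz, hzlen⟩ := exists_long_mem_Kstar hx hxne n
  obtain ⟨u, v, huv⟩ := hsync
  replace huv := huv.append hz hz
  obtain ⟨p₀, a, rfl⟩ := (List.eq_nil_or_concat' x).resolve_left hxne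
  let e : B ≃ Option A := Fintype.equivOfCardEq (by rw [hcard, Fintype.card_option])
  let f : B → A := fun c => (e c).getD a
  let g : A → B := fun c => e.symm (some c)
  let b : B := e.symm none
  have hfg : ∀ c, f (g c) = c := fun c => by simp [f, g]
  have hgb : ∀ c, g c ≠ b := fun c => by simp [g, b]
  have hfb : f b = a := by simp [f, b]
  set R : Set (List A) := {p | ∃ y ∈ Kstar X, y ++ p = v ++ z ++ p₀} with hRdef
  obtain ⟨w, hw, hwr⟩ := hR (markedSet X R f b)
    ((List.finite_length_le B n).subset fun y hy => length_le_of_mem_markedSet hlen hy)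
    (fun y hy => length_le_of_mem_markedSet hlen hy)
    (not_isCompleteSet_markedSet hX hlen huv (by simp; omega)
      (hfb.symm ▸ hx) hfg hgb)
  by_contra! hcon
  have hsplit : ∀ w₁ w₂, w = w₁ ++ b :: w₂ → ∃ l z p, z ∈ Kstar X ∧ p ∈ ProperPrefixes X ∧
      l ++ w₁.map f = z ++ p ∧ p ∉ R := by
    rintro w₁ w₂ rfl
    obtain ⟨l, y, p, hy, hp, h, hc⟩ := hcon (w₁.map f) (v ++ z ++ p₀) (by simp at hwr ⊢; omega)
    exact ⟨l, y, p, hy, hp, h, fun ⟨y', hy', h'⟩ => hc y' hy' h'⟩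
  obtain ⟨l, s, hls⟩ := hcomp (w.map f)
  obtain ⟨y, p, q, y', hy, -, e₁, -, hs⟩ := exists_straddles hls
  have hp : p ∈ ProperPrefixes X := by
    rcases hs with ⟨rfl, -⟩ | ⟨-, hq, hpq⟩
    exacts [⟨_, hxne, hx⟩, ⟨q, hq, hpq⟩]
  obtain ⟨l', z', p', hz', e', rfl⟩ := exists_lift_of_prefix hfg w hsplit hy hp e₁
  rcases hs with ⟨h0, -⟩ | ⟨-, hq, hpq⟩
  · obtain rfl : p' = [] := by simpa using h0
    refine hw l' [] ?_
    simpa [e'] using hz'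
  · refine hw l' (q.map g) ?_
    rw [e', List.append_assoc]
    refine append_mem_Kstar_s4 hz' (mem_Kstar_of_mem (Or.inl ⟨?_, fun m hm => ?_⟩))
    · simpa [Function.comp_def, hfg] using hpq
    · obtain ⟨q', c, rfl⟩ := (List.eq_nil_or_concat' q).resolve_left hq
      rw [List.map_append, ← List.append_assoc] at hm
      have := (List.append_inj' hm rfl).2
      exact hgb c (by simpa using this)

theorem exists_right_resolving_word {A B : Type*} [Fintype A] [Fintype B] {n r : ℕ}
    (hcard : Fintype.card B = Fintype.card A + 1) {X : Set (List A)}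
    (hlen : ∀ w ∈ X, w.length ≤ n) (hX : IsCode X) (hcomp : IsCompleteSet X)
    (hsync : IsSynchronizing X) (hne : ∃ x ∈ X, x ≠ [])
    (hR : ∀ Y : Set (List B), Y.Finite → (∀ w ∈ Y, w.length ≤ n) → ¬ IsCompleteSet Y →
      ∃ w : List B, (∀ p s : List B, p ++ w ++ s ∉ Kstar Y) ∧ w.length ≤ r) :
    ∃ w c : List A, w.length + 1 ≤ r ∧ ∀ s z q t, z ∈ Kstar X → t ≠ [] → t ++ q ∈ X →
      w ++ s = q ++ z → ∃ y ∈ Kstar X, q ++ y = c := by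
  obtain ⟨x, hx, hxne⟩ := hne
  obtain ⟨u, v, huv⟩ := hsync
  obtain ⟨w, c, hw, h⟩ := exists_left_resolving_word hcard (X := List.reverse ⁻¹' X)
    (fun w hw => by simpa using hlen _ hw) hX.reverse hcomp.reverse ⟨_, _, huv.reverse⟩
    ⟨x.reverse, by simpa using hx, by simpa using hxne⟩ hR
  refine ⟨w.reverse, c.reverse, by simpa using hw, fun s z q t hz ht htq e => ?_⟩
  obtain ⟨y, hy, rfl⟩ := h s.reverse z.reverse q.reverse (mem_Kstar_reverse.2 (by simpa using hz))
    ⟨t.reverse, by simpa using ht, by simpa using htq⟩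
    (by simpa using congrArg List.reverse e)
  exact ⟨y.reverse, mem_Kstar_reverse.1 hy, by simp⟩

/-- Main result: if every finite incomplete set over a `(d+1)`-letter alphabet with words of
length at most `n` has an incompletable word of length at most `r`, then every finite complete
synchronizing code over a `d`-letter alphabet with words of length at most `n` has a
synchronizing pair `(u, v)` with `|uv| ≤ 2r + 2n - 2`. -/
theorem syncPair_length_le {A B : Type*} [Fintype A] [Fintype B] (d n r : ℕ)
    (hA : Fintype.card A = d) (hB : Fintype.card B = d + 1) (hn : 1 ≤ n) (hr : 0 < r)
    (X : Set (List A)) (hXfin : X.Finite) (hXlen : ∀ w ∈ X, w.length ≤ n)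
    (hXcode : IsCode X) (hXcomp : IsCompleteSet X) (hXsync : IsSynchronizing X)
    (hR : ∀ Y : Set (List B), Y.Finite → (∀ w ∈ Y, w.length ≤ n) → ¬ IsCompleteSet Y →
      ∃ w : List B, (∀ p s : List B, p ++ w ++ s ∉ Kstar Y) ∧ w.length ≤ r) :
    ∃ u v : List A, IsSyncPair X u v ∧ (u ++ v).length ≤ 2 * r + 2 * n - 2 := by
  by_cases hne : ∃ x ∈ X, x ≠ []
  · have hcard : Fintype.card B = Fintype.card A + 1 := by rw [hB, hA]
    obtain ⟨w, c, hw, hl⟩ := exists_left_resolving_word hcard hXlen hXcode hXcomp hXsync hne hR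
    obtain ⟨w', c', hw', hr'⟩ :=
      exists_right_resolving_word hcard hXlen hXcode hXcomp hXsync hne hR
    obtain ⟨x, hx, hxne⟩ := hne
    have hres : ∀ l z p q z' s, z ∈ Kstar X → z' ∈ Kstar X → Straddles X p q →
        l ++ w = z ++ p → w' ++ s = q ++ z' →
        (∃ y ∈ Kstar X, y ++ p = c) ∧ ∃ y ∈ Kstar X, q ++ y = c' := by
      intro l z p q z' s hz hz' hs e e'
      have hp : ∃ t, t ≠ [] ∧ p ++ t ∈ X := by
        rcases hs with ⟨rfl, -⟩ | ⟨-, hq, hpq⟩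
        exacts [⟨x, hxne, hx⟩, ⟨q, hq, hpq⟩]
      have hq : ∃ t, t ≠ [] ∧ t ++ q ∈ X := by
        rcases hs with ⟨-, rfl⟩ | ⟨hp, -, hpq⟩
        exacts [⟨x, hxne, by simpa using hx⟩, ⟨p, hp, hpq⟩]
      obtain ⟨t, ht, htq⟩ := hq
      exact ⟨hl l z p hz hp e, hr' s z' q t hz' ht htq e'⟩
    obtain ⟨l, s, hln, hsn, h⟩ := exists_short_completion hXlen (hXcomp (w ++ w'))
    obtain ⟨z, p, q, z', hz, hz', e, e', hs⟩ := exists_straddles (g := l ++ w) (h := w' ++ s)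
      (by simpa using h)
    refine ⟨z, p ++ q ++ z', ⟨hz, append_mem_Kstar_s4 hs.append_mem_Kstar hz', fun i j hij => ?_⟩, ?_⟩
    · have hsplit : i ++ (z ++ (p ++ q ++ z')) ++ j = (i ++ l ++ w) ++ (w' ++ (s ++ j)) := by
        have : i ++ (z ++ (p ++ q ++ z')) ++ j = i ++ (z ++ p) ++ (q ++ z') ++ j := by simp
        rw [this, ← e, ← e']
        simp
      rw [hsplit] at hij
      obtain ⟨y, p', q', y', hy, hy', f, f', hs'⟩ := exists_straddles hij
      obtain ⟨⟨a, ha, hac⟩, b, hb, hbc⟩ := hres _ _ _ _ _ _ hz hz' hs e e'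
      obtain ⟨⟨a', ha', hac'⟩, b', hb', hbc'⟩ := hres _ _ _ _ _ _ hy hy' hs' f f'
      obtain ⟨rfl, rfl⟩ := hXcode.straddles_unique ha hb ha' hb' hs hs'
        (hac.trans hac'.symm) (hbc.trans hbc'.symm)
      have h1 : i ++ z = y := by
        rw [List.append_assoc, e, ← List.append_assoc] at f
        exact List.append_cancel_right f
      have h2 : z' ++ j = y' := by
        rw [← List.append_assoc, e', List.append_assoc] at f'
        exact List.append_cancel_left f'
      refine ⟨h1 ▸ hy, ?_⟩
      rw [List.append_assoc, h2]
      exact append_mem_Kstar_s4 hs'.append_mem_Kstar hy'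
    · have h1 := congrArg List.length e
      have h2 := congrArg List.length e'
      simp only [List.length_append] at h1 h2 ⊢
      omega
  · have hnil : ∀ w ∈ Kstar X, w = [] := by
      rintro _ ⟨l, hl, rfl⟩
      refine List.flatten_eq_nil_iff.2 fun x hx => ?_
      by_contra h
      exact hne ⟨x, hl x hx, h⟩
    have hall : ∀ w : List A, w = [] := fun w => by
      obtain ⟨i, j, h⟩ := hXcomp w
      have := hnil _ h
      simp_all
    have hmem : ∀ w : List A, w ∈ Kstar X := fun w => hall w ▸ nil_mem_Kstar
    exact ⟨[], [], ⟨hmem _, hmem _, fun _ _ _ => ⟨hmem _, hmem _⟩⟩, by simp⟩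
end

section
/- Let A be a finite alphabet and let Y ⊆ A* be a complete set such that the language Y* is regular (i.e., Y* is accepted by a deterministic finite automaton with finitely many states). Then every word w ∈ A* has a Y-completion (y, s) with y ∈ Y*. -/
/-- Let `L` be the language of a DFA. If no word `y ++ w` with `y ∈ L` is a prefix of a word of
`L`, then for every finite set `T` of states there is a word `u` such that `r ++ u` is not a prefix
of a word of `L` whenever `r` leads to a state of `T`. -/
theorem exists_dead_word_of_eval_mem {A σ : Type*} (M : DFA A σ) (w : List A)
    (hw : ∀ y ∈ M.accepts, ∀ s, y ++ w ++ s ∉ M.accepts) (T : Finset σ) :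
    ∃ u : List A, ∀ r, M.eval r ∈ T → ∀ s, r ++ u ++ s ∉ M.accepts := by
  classical
  induction T using Finset.induction_on with
  | empty => exact ⟨[], by simp⟩
  | insert q T _ ih =>
    obtain ⟨u, hu⟩ := ih
    by_cases hq : ∃ x, M.evalFrom q (u ++ x) ∈ M.accept
    · obtain ⟨x, hx⟩ := hq
      refine ⟨u ++ x ++ w, fun r hr s hs => ?_⟩
      rcases Finset.mem_insert.mp hr with h | h
      · have hrux : r ++ (u ++ x) ∈ M.accepts := by
          rw [DFA.mem_accepts, DFA.eval, DFA.evalFrom_of_append]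
          subst h
          exact hx
        exact hw _ hrux s (by simpa only [List.append_assoc] using hs)
      · exact hu r h (x ++ w ++ s) (by simpa only [List.append_assoc] using hs)
    · refine ⟨u, fun r hr s hs => ?_⟩
      rcases Finset.mem_insert.mp hr with h | h
      · refine hq ⟨s, ?_⟩
        rw [List.append_assoc, DFA.mem_accepts, DFA.eval, DFA.evalFrom_of_append] at hs
        exact h ▸ hs
      · exact hu r h s hs

/-- If `Y` is complete and `Y*` is regular (accepted by a DFA with finitely many states),
then every word `w` has a `Y`-completion `(y, s)` with `y ∈ Y*`. -/
theorem completion_left_in_kstar {A : Type*} [Fintype A] (Y : Set (List A))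
    (hcomp : IsCompleteSet Y)
    (hreg : ∃ (σ : Type) (_ : Fintype σ) (M : DFA A σ),
      ∀ w : List A, w ∈ M.accepts ↔ w ∈ Kstar Y) :
    ∀ w : List A, ∃ y s : List A, y ∈ Kstar Y ∧ y ++ w ++ s ∈ Kstar Y := by
  obtain ⟨σ, _, M, hM⟩ := hreg
  intro w
  by_contra! hw
  obtain ⟨u, hu⟩ := exists_dead_word_of_eval_mem M w
    (fun y hy s hs => hw y s ((hM y).mp hy) ((hM _).mp hs)) Finset.univ
  obtain ⟨r, s, hrs⟩ := hcomp u
  exact hu r (Finset.mem_univ _) s ((hM _).mpr hrs)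
end

section
/- Let A and B be finite alphabets, let h : A* → B* be an injective monoid morphism such that h(A) is a prefix code, and let Y ⊆ A*. Then h(Y) is complete if and only if both Y and h(A) are complete. -/
theorem mlift_append_s8 {A B : Type*} (f : A → List B) (u v : List A) :
    mlift f (u ++ v) = mlift f u ++ mlift f v := by
  simp [mlift]

theorem mlift_cons_s8 {A B : Type*} (f : A → List B) (a : A) (v : List A) :
    mlift f (a :: v) = f a ++ mlift f v := by
  simp [mlift]

theorem mlift_flatten {A B : Type*} (f : A → List B) (l : List (List A)) :
    mlift f l.flatten = (l.map (mlift f)).flatten := by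
  induction l with
  | nil => rfl
  | cons x l ih => simp [mlift_append_s8, ih]

/-- The star of the image of `Y` is the image of the star of `Y`. -/
theorem Kstar_image_mlift {A B : Type*} (f : A → List B) (Y : Set (List A)) :
    Kstar (mlift f '' Y) = mlift f '' Kstar Y := by
  ext w
  constructor
  · rintro ⟨l, hl, rfl⟩
    induction l with
    | nil => exact ⟨[], ⟨[], by simp, rfl⟩, rfl⟩
    | cons x l ih =>
      obtain ⟨y, hy, rfl⟩ := hl x (by simp)
      obtain ⟨z, ⟨m, hm, rfl⟩, hz⟩ := ih fun x hx => hl x (by simp [hx])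
      refine ⟨y ++ m.flatten, ⟨y :: m, ?_, by simp⟩, by simp [mlift_append_s8, hz]⟩
      simpa using ⟨hy, hm⟩
  · rintro ⟨_, ⟨l, hl, rfl⟩, rfl⟩
    refine ⟨l.map (mlift f), ?_, (mlift_flatten f l).symm⟩
    intro x hx
    obtain ⟨y, hy, rfl⟩ := List.mem_map.1 hx
    exact ⟨y, hl y hy, rfl⟩

/-- The star of the image of the alphabet is the range of the morphism. -/
theorem Kstar_range {A B : Type*} (f : A → List B) :
    Kstar (Set.range f) = Set.range (mlift f) := by
  ext w
  constructor
  · rintro ⟨l, hl, rfl⟩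
    induction l with
    | nil => exact ⟨[], rfl⟩
    | cons x l ih =>
      obtain ⟨a, rfl⟩ := hl x (by simp)
      obtain ⟨z, hz⟩ := ih fun x hx => hl x (by simp [hx])
      exact ⟨a :: z, by simp [mlift_cons_s8, hz]⟩
  · rintro ⟨z, rfl⟩
    refine ⟨z.map f, ?_, rfl⟩
    intro x hx
    obtain ⟨a, _, rfl⟩ := List.mem_map.1 hx
    exact ⟨a, rfl⟩

/-- A prefix encoding reflects the prefix order. -/
theorem prefix_of_mlift_prefix_s8 {A B : Type*} {f : A → List B}
    (hinj : Function.Injective (mlift f)) (hpref : IsPrefixCode (Set.range f))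
    (z y : List A) (h : mlift f z <+: mlift f y) : z <+: y := by
  have hf : ∀ a b, f a <+: f b → a = b := by
    intro a b hab
    have hfab := hpref.1 _ ⟨a, rfl⟩ _ ⟨b, rfl⟩ hab
    have : [a] = [b] := hinj (by simp [mlift, hfab])
    simpa using this
  induction z generalizing y with
  | nil => simp
  | cons a z ih =>
    cases y with
    | nil =>
      have h0 : mlift f (a :: z) = mlift f [] := List.prefix_nil.1 h
      simpa using hinj h0
    | cons b y =>
      rw [mlift_cons_s8, mlift_cons_s8] at h
      have hab : a = b := by
        rcases List.prefix_or_prefix_of_prefix ((List.prefix_append _ _).trans h)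
          (List.prefix_append (f b) _) with h' | h'
        · exact hf _ _ h'
        · exact (hf _ _ h').symm
      subst hab
      rw [List.prefix_append_right_inj] at h
      exact (List.prefix_append_right_inj [a]).2 (ih y h)

/-- Cutting the image of a word at an arbitrary position: the left part ends in a prefix of the
image of a letter. -/
theorem exists_split_of_append_eq_mlift {A B : Type*} (f : A → List B) (y : List A)
    (r v : List B) (h : r ++ v = mlift f y) :
    ∃ y₁ y₂ p, y = y₁ ++ y₂ ∧ r = mlift f y₁ ++ p ∧ p ++ v = mlift f y₂ ∧
      (p = [] ∨ ∃ a, p <+: f a) := by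
  induction y generalizing r with
  | nil =>
    obtain ⟨rfl, rfl⟩ := List.append_eq_nil_iff.1 h
    exact ⟨[], [], [], rfl, rfl, rfl, Or.inl rfl⟩
  | cons a y ih =>
    have h' := h
    rw [mlift_cons_s8] at h'
    rcases List.prefix_or_prefix_of_prefix (List.prefix_append r v)
      (h' ▸ List.prefix_append (f a) (mlift f y)) with hr | ⟨r', rfl⟩
    · exact ⟨[], a :: y, r, rfl, rfl, h, Or.inr ⟨a, hr⟩⟩
    · rw [List.append_assoc, List.append_cancel_left_eq] at h'
      obtain ⟨y₁, y₂, p, rfl, rfl, h₂, h₃⟩ := ih r' h'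
      exact ⟨a :: y₁, y₂, p, rfl, by simp [mlift_cons_s8], h₂, h₃⟩

/-- For every finite list `P` of words and every word `c`, some word `u` is such that, for every
`p ∈ P`, if `p ++ u` is a prefix of a word of `X`, then `c` occurs in `u` at a position where the
part of `p ++ u` on its left is a word of `X`. -/
theorem exists_aligning_word {B : Type*} (X : Set (List B)) (c : List B) (P : List (List B)) :
    ∃ u : List B, ∀ p ∈ P, ∀ s, p ++ u ++ s ∈ X →
      ∃ t t', u = t ++ c ++ t' ∧ p ++ t ∈ X := by
  induction P with
  | nil => exact ⟨[], by simp⟩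
  | cons p P ih =>
    obtain ⟨u, hu⟩ := ih
    by_cases hp : ∃ s, p ++ u ++ s ∈ X
    · obtain ⟨s₀, hs₀⟩ := hp
      refine ⟨u ++ s₀ ++ c, fun q hq s hs => ?_⟩
      rcases List.mem_cons.1 hq with rfl | hq
      · exact ⟨u ++ s₀, [], by simp, by simpa using hs₀⟩
      · obtain ⟨t, t', rfl, ht⟩ := hu q hq (s₀ ++ c ++ s) (by simpa using hs)
        exact ⟨t, t' ++ s₀ ++ c, by simp, ht⟩
    · refine ⟨u, fun q hq s hs => ?_⟩
      rcases List.mem_cons.1 hq with rfl | hq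
      · exact absurd ⟨s, hs⟩ hp
      · exact hu q hq s hs

/-- Let `h : A* → B*` be a prefix encoding (an injective morphism whose image of the letters
is a prefix code), and `Y ⊆ A*`. Then `h(Y)` is complete iff `Y` and `h(A)` are complete. -/
theorem image_complete_iff {A B : Type*} [Fintype A] [Fintype B] (f : A → List B)
    (hinj : Function.Injective (mlift f)) (hpref : IsPrefixCode (Set.range f))
    (Y : Set (List A)) :
    IsCompleteSet (mlift f '' Y) ↔ (IsCompleteSet Y ∧ IsCompleteSet (Set.range f)) := by
  simp only [IsCompleteSet, Kstar_image_mlift, Kstar_range]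
  constructor
  · refine fun H => ⟨fun w => ?_, fun w => ?_⟩
    · obtain ⟨u, hu⟩ := exists_aligning_word (Set.range (mlift f)) (mlift f w)
        ([] :: (Finset.univ : Finset A).toList.flatMap fun a => (f a).inits)
      obtain ⟨r, s, y, hy, hrs⟩ := H u
      obtain ⟨y₁, y₂, p, rfl, rfl, h₂, hp⟩ :=
        exists_split_of_append_eq_mlift f y r (u ++ s) (by simp [hrs])
      obtain ⟨t, t', rfl, z, hz⟩ := hu p (by simpa using hp) s ⟨y₂, by simp [← h₂]⟩
      have hzw : mlift f (z ++ w) <+: mlift f y₂ :=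
        ⟨t' ++ s, by rw [mlift_append_s8, hz, ← h₂]; simp⟩
      obtain ⟨q, rfl⟩ := prefix_of_mlift_prefix_s8 hinj hpref _ _ hzw
      exact ⟨y₁ ++ z, q, by simpa using hy⟩
    · obtain ⟨r, s, y, -, hy⟩ := H w
      exact ⟨r, s, y, hy⟩
  · rintro ⟨hY, hA⟩ w
    obtain ⟨r, s, a, ha⟩ := hA w
    obtain ⟨r', s', h⟩ := hY a
    exact ⟨mlift f r' ++ r, s ++ mlift f s', _, h, by simp [mlift_append_s8, ha]⟩
end
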